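/- arXiv:1801.03988 — 3 statements merged into one kernel-verified Lean document; each statement's English description precedes it below -/
import Mathlib

section
/- For a K-positive map A, the following are equivalent: (1) A is K-ergodic; (2) r(A) > 0, the eigenvalue r(A) of A has geometric multiplicity 1, and there exist eigenvectors x₀ ∈ K of A and y₀ ∈ K* of A* associated with r(A) satisfying ⟨y₀,x₀⟩ = 1; (3) r(A) > 0 and the eigenvalue r(A) of A has algebraic multiplicity 1. -/
open Filter Topology RealInnerProductSpace

variable {V : Type*} [NormedAddCommGroup V] [InnerProductSpace ℝ V] [FiniteDimensional ℝ V]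

/-- The dual cone of a set `K`. -/
def dualSet (K : Set V) : Set V := {y | ∀ x ∈ K, 0 ≤ ⟪y, x⟫}

/-- The spectral radius via the Gelfand formula. -/
noncomputable def specRad (A : V →L[ℝ] V) : ℝ :=
  Filter.limsup (fun n : ℕ => ‖A ^ n‖ ^ ((n : ℝ)⁻¹)) Filter.atTop

/-- `A` is `K`-ergodic with stationary vector `x₀` and dual stationary vector `y₀`. -/
def IsErgodicWith (K : Set V) (A : V →L[ℝ] V) (x₀ y₀ : V) : Prop :=
  0 < specRad A ∧ x₀ ∈ K ∧ y₀ ∈ dualSet K ∧ ⟪y₀, x₀⟫ = 1 ∧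
    ∀ x : V, Tendsto
      (fun n : ℕ => (n : ℝ)⁻¹ • ∑ k ∈ Finset.range n, (((specRad A)⁻¹ • A) ^ k) x)
      atTop (𝓝 (⟪y₀, x⟫ • x₀))

/-- `A` is `K`-ergodic. -/
def IsErgodic (K : Set V) (A : V →L[ℝ] V) : Prop := ∃ x₀ y₀, IsErgodicWith K A x₀ y₀

/-- `A` is `K`-mixing with stationary vector `x₀` and dual stationary vector `y₀`. -/
def IsMixingWith (K : Set V) (A : V →L[ℝ] V) (x₀ y₀ : V) : Prop :=
  0 < specRad A ∧ x₀ ∈ K ∧ y₀ ∈ dualSet K ∧ ⟪y₀, x₀⟫ = 1 ∧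
    ∀ x : V, Tendsto (fun n : ℕ => (((specRad A)⁻¹ • A) ^ n) x) atTop (𝓝 (⟪y₀, x⟫ • x₀))

/-- `A` is `K`-mixing. -/
def IsMixing (K : Set V) (A : V →L[ℝ] V) : Prop := ∃ x₀ y₀, IsMixingWith K A x₀ y₀

/-- Uniformly positive functional on the cone. -/
lemma aux_functional (K : Set V) (hKcl : IsClosed K) (hKconv : Convex ℝ K)
    (hKcone : ∀ c : ℝ, 0 ≤ c → ∀ x ∈ K, c • x ∈ K) (hKpt : K ∩ (-K) = {(0 : V)}) :
    ∃ f : V →L[ℝ] ℝ, ∃ u : ℝ, 0 < u ∧ ∀ x ∈ K, u * ‖x‖ ≤ f x := by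
  have hneg : ∀ x ∈ K, -x ∈ K → x = 0 := by
    intro x hx hx'
    have : x ∈ K ∩ (-K) := ⟨hx, by simpa using hx'⟩
    rw [hKpt] at this
    simpa using this
  set S := K ∩ Metric.sphere (0 : V) 1 with hSdef
  have hcomp : IsCompact S := (isCompact_sphere (0 : V) 1).inter_left hKcl
  have hsep : ∀ x : V, ∃ g : V →L[ℝ] ℝ, x ∈ S → (∀ b ∈ K, 0 ≤ g b) ∧ 0 < g x := by
    intro x
    by_cases hx : x ∈ S
    swap
    · exact ⟨0, fun h => absurd h hx⟩
    have hnx : -x ∉ K := by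
      intro h
      have h1 := hx.2
      rw [hneg x hx.1 h] at h1
      simp at h1
    obtain ⟨g, u, hu, hg⟩ := geometric_hahn_banach_point_closed hKconv hKcl hnx
    have hu0 : u < 0 := by
      have := hg _ (hKcone 0 le_rfl x hx.1)
      simpa using this
    refine ⟨g, fun _ => ⟨fun b hb => ?_, ?_⟩⟩
    · by_contra hlt
      push Not at hlt
      have := hg _ (hKcone (u / g b) (div_nonneg_of_nonpos hu0.le hlt.le) b hb)
      rw [map_smul, smul_eq_mul, div_mul_cancel₀ _ hlt.ne] at this
      exact lt_irrefl _ this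
    · rw [map_neg] at hu
      linarith
  choose g hg using hsep
  obtain ⟨T, hTS, hT⟩ := hcomp.elim_nhds_subcover (fun x => {y | 0 < g x y}) (fun x hx =>
    (isOpen_lt continuous_const (g x).continuous).mem_nhds (hg x hx).2)
  let f : V →L[ℝ] ℝ := ∑ x ∈ T, g x
  have hfapp : ∀ y, f y = ∑ x ∈ T, g x y := by
    intro y
    simp [f]
  have hfpos : ∀ y ∈ S, 0 < f y := by
    intro y hy
    rw [hfapp]
    obtain ⟨x, hxT, hxy⟩ := Set.mem_iUnion₂.1 (hT hy)
    exact Finset.sum_pos' (fun i hi => (hg i (hTS i hi)).1 y hy.1) ⟨x, hxT, hxy⟩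
  obtain ⟨u, hu, hf⟩ := hcomp.exists_forall_le' f.continuous.continuousOn hfpos
  refine ⟨f, u, hu, ?_⟩
  intro x hx
  by_cases hx0 : x = 0
  · simp [hx0]
  have hn : 0 < ‖x‖ := norm_pos_iff.2 hx0
  have := hf (‖x‖⁻¹ • x) ⟨hKcone _ (by positivity) x hx, by
    simp [norm_smul, hn.ne']⟩
  rw [map_smul, smul_eq_mul, le_inv_mul_iff₀ hn] at this
  linarith

/-- Norm of positive operators is controlled by a functional. -/
lemma aux_norm (K : Set V) (hKcl : IsClosed K) (hKconv : Convex ℝ K)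
    (hKcone : ∀ c : ℝ, 0 ≤ c → ∀ x ∈ K, c • x ∈ K)
    (hKint : (interior K).Nonempty) (hKpt : K ∩ (-K) = {(0 : V)}) :
    ∃ f : V →L[ℝ] ℝ, ∃ e ∈ K, ∃ C : ℝ, 0 ≤ C ∧ ∀ T : V →L[ℝ] V, (∀ x ∈ K, T x ∈ K) →
      0 ≤ f (T e) ∧ ‖T‖ ≤ C * f (T e) := by
  obtain ⟨f, u, hu, hf⟩ := aux_functional K hKcl hKconv hKcone hKpt
  obtain ⟨e, he⟩ := hKint
  have heK := interior_subset he
  obtain ⟨ε, hε, hball⟩ := Metric.nhds_basis_closedBall.mem_iff.1 (mem_interior_iff_mem_nhds.1 he)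
  refine ⟨f, e, heK, (u * ε)⁻¹, by positivity, ?_⟩
  intro T hT
  have hpos : 0 ≤ f (T e) := le_trans (by positivity) (hf _ (hT e heK))
  refine ⟨hpos, ?_⟩
  have key : ∀ v, ‖v‖ ≤ ε → u * ‖T v‖ ≤ f (T e) := by
    intro v hv
    have h1 := hf _ (hT (e + v) (hball (by simpa using hv)))
    have h2 := hf _ (hT (e - v) (hball (by simpa using hv)))
    simp only [map_add, map_sub] at h1 h2
    have h3 : ‖(2:ℝ) • T v‖ ≤ ‖T e + T v‖ + ‖T e - T v‖ := by
      have : (2:ℝ) • T v = (T e + T v) - (T e - T v) := by rw [two_smul]; abel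
      rw [this]; exact norm_sub_le _ _
    rw [norm_smul] at h3
    norm_num at h3
    nlinarith
  refine ContinuousLinearMap.opNorm_le_bound _ (by positivity) ?_
  intro v
  by_cases hv : v = 0
  · simp [hv]
  have hn : 0 < ‖v‖ := norm_pos_iff.2 hv
  have h := key ((ε * ‖v‖⁻¹) • v) (by
    rw [norm_smul, Real.norm_of_nonneg (by positivity)]
    field_simp; rfl)
  rw [map_smul, norm_smul, Real.norm_of_nonneg (by positivity)] at h
  have h4 : ‖T v‖ = (u * ε)⁻¹ * (u * (ε * ‖v‖⁻¹ * ‖T v‖)) * ‖v‖ := by field_simp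
  rw [h4]
  gcongr

/-- Fixed-space projection. -/
lemma aux_proj (B : V →L[ℝ] V) (h : ∀ x, B (B x - x) = B x - x → B x = x) :
    ∃ P : V →L[ℝ] V, (∀ x, B (P x) = P x) ∧ (∀ x, B x = x → P x = x) ∧
      ∀ x, ∃ z, x = P x + (B z - z) := by
  let D : V →ₗ[ℝ] V := (B : V →ₗ[ℝ] V) - 1
  have hD : ∀ x, D x = B x - x := fun x => rfl
  have hdisj : Disjoint (LinearMap.ker D) (LinearMap.range D) := by
    rw [Submodule.disjoint_def]
    rintro x hx ⟨z, rfl⟩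
    rw [LinearMap.mem_ker, hD, hD, sub_eq_zero] at hx
    rw [hD, h z hx, sub_self]
  have hc : IsCompl (LinearMap.ker D) (LinearMap.range D) := by
    refine ⟨hdisj, codisjoint_iff.mpr (Submodule.eq_top_of_disjoint _ _ ?_ hdisj)⟩
    have := D.finrank_range_add_finrank_ker
    omega
  refine ⟨LinearMap.toContinuousLinearMap (Submodule.projection _ _ hc), ?_, ?_, ?_⟩
  · intro x
    have : Submodule.projection _ _ hc x ∈ LinearMap.ker D := Submodule.projection_apply_mem hc x
    rw [LinearMap.mem_ker, hD, sub_eq_zero] at this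
    exact this
  · intro x hx
    have : x ∈ LinearMap.ker D := by rw [LinearMap.mem_ker, hD, hx, sub_self]
    exact Submodule.projection_apply_of_mem_left hc this
  · intro x
    obtain ⟨z, hz⟩ := Submodule.sub_projection_mem hc x
    refine ⟨z, ?_⟩
    rw [← hD, hz]
    simp

/-- Abel means of `B` are bounded near `1`. -/
lemma aux_abel (B : V →L[ℝ] V) (h : ∀ x, B (B x - x) = B x - x → B x = x) :
    ∃ C : ℝ, ∀ᶠ t in 𝓝[<] (1:ℝ), ∀ S : V →L[ℝ] V, S * (1 - t • B) = 1 →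
      ‖(1 - t) • S‖ ≤ C := by
  obtain ⟨P, hP1, hP2, -⟩ := aux_proj B h
  have hBP : B * P = P := by ext x; exact hP1 x
  let U : ℝ → (V →L[ℝ] V) := fun t => 1 - t • B + P
  have hUc : Continuous U := by fun_prop
  have hU1 : IsUnit (U 1) := by
    have hinj : LinearMap.ker ((U 1 : V →L[ℝ] V) : V →ₗ[ℝ] V) = ⊥ := by
      rw [LinearMap.ker_eq_bot']
      intro x hx
      have hx : x - B x + P x = 0 := by simpa [U] using hx
      have h1 : B x - x = P x := by
        have : B x - x = P x - (x - B x + P x) := by abel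
        rw [this, hx, sub_zero]
      have h2 : B x = x := h x (by rw [h1, hP1])
      rw [h2, hP2 x h2] at hx
      simpa using hx
    have := (LinearMap.isUnit_iff_ker_eq_bot _).2 hinj
    have h3 := this.map (Module.End.toContinuousLinearMap V)
    exact h3
  have hev : ∀ᶠ t in 𝓝 (1:ℝ), IsUnit (U t) :=
    hUc.continuousAt.eventually (Units.isOpen.mem_nhds hU1)
  have hlim : Tendsto (fun t : ℝ => ‖((1 - t) • (1 : V →L[ℝ] V) + P) * Ring.inverse (U t)‖) (𝓝 1)
      (𝓝 ‖((1 - (1:ℝ)) • (1 : V →L[ℝ] V) + P) * Ring.inverse (U 1)‖) := by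
    have hinv : Tendsto (fun t => Ring.inverse (U t)) (𝓝 1) (𝓝 (Ring.inverse (U 1))) := by
      obtain ⟨w, hw⟩ := hU1
      have := NormedRing.inverse_continuousAt w
      rw [hw] at this
      exact this.tendsto.comp hUc.continuousAt.tendsto
    refine (Tendsto.mul ?_ hinv).norm
    have : Continuous (fun t : ℝ => (1 - t) • (1 : V →L[ℝ] V) + P) := by fun_prop
    exact this.tendsto 1
  refine ⟨‖((1 - (1:ℝ)) • (1 : V →L[ℝ] V) + P) * Ring.inverse (U 1)‖ + 1, ((hev.and (hlim.eventually (Iic_mem_nhds (lt_add_one _)))).filter_mono nhdsWithin_le_nhds).mono ?_⟩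
  rintro t ⟨hu, hle⟩ S hS
  refine le_trans (le_of_eq ?_) hle
  congr 1
  have hSP : (1 - t) • (S * P) = P := by
    calc (1 - t) • (S * P) = S * (1 - t • B) * P := by
          rw [mul_assoc, sub_mul, one_mul, smul_mul_assoc, hBP, mul_sub, mul_smul_comm, sub_smul,
            one_smul]
      _ = P := by rw [hS, one_mul]
  have hTU : ((1 - t) • S) * U t = (1 - t) • (1 : V →L[ℝ] V) + P := by
    simp only [U]
    rw [mul_add, smul_mul_assoc, hS, smul_mul_assoc, hSP]
  rw [← hTU, mul_assoc, Ring.mul_inverse_cancel _ hu, mul_one]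

/-- The power series converges inside the disc. -/
lemma aux_summable (A : V →L[ℝ] V) (hr : 0 < specRad A) (t : ℝ) (ht0 : 0 < t) (ht1 : t < 1) :
    Summable (fun n : ℕ => t ^ n • ((specRad A)⁻¹ • A) ^ n) := by
  obtain ⟨y, hty, hy1⟩ := exists_between ht1
  have hy0 : 0 < y := ht0.trans hty
  set r := specRad A with hrdef
  have hbdd : IsBoundedUnder (· ≤ ·) atTop (fun n : ℕ => ‖A ^ n‖ ^ ((n : ℝ)⁻¹)) := by
    refine ⟨‖A‖, ?_⟩
    rw [eventually_map]
    filter_upwards [eventually_ge_atTop 1] with n hn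
    have hn0 : (n : ℝ) ≠ 0 := by positivity
    calc ‖A ^ n‖ ^ ((n : ℝ)⁻¹) ≤ (‖A‖ ^ n) ^ ((n : ℝ)⁻¹) := by
          gcongr
          exact norm_pow_le' A hn
      _ = ‖A‖ := Real.pow_rpow_inv_natCast (norm_nonneg _) (by omega)
  have hlt : limsup (fun n : ℕ => ‖A ^ n‖ ^ ((n : ℝ)⁻¹)) atTop < r / y := by
    change r < r / y
    rw [lt_div_iff₀ hy0]
    nlinarith
  have hev := eventually_lt_of_limsup_lt hlt hbdd
  have hgeo : Summable (fun n : ℕ => (t / y) ^ n) :=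
    summable_geometric_of_lt_one (by positivity) ((div_lt_one hy0).2 hty)
  refine Summable.of_norm_bounded_eventually_nat hgeo ?_
  filter_upwards [hev, eventually_ge_atTop 1] with n hn hn1
  have h1 : ‖A ^ n‖ ≤ (r / y) ^ n := by
    have := Real.rpow_inv_natCast_pow (norm_nonneg (A ^ n)) (n := n) (by omega)
    rw [← this]
    gcongr
  rw [smul_pow, norm_smul, norm_smul, norm_pow, norm_pow, Real.norm_of_nonneg ht0.le,
    Real.norm_of_nonneg (inv_nonneg.2 hr.le)]
  calc t ^ n * (r⁻¹ ^ n * ‖A ^ n‖) ≤ t ^ n * (r⁻¹ ^ n * (r / y) ^ n) := by gcongr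
    _ = (t / y) ^ n := by
      rw [← mul_pow, ← mul_pow]
      congr 1
      field_simp

/-- Averaged boundedness plus submultiplicativity gives boundedness. -/
lemma aux_markov (b : ℕ → ℝ) (hb : ∀ n, 0 ≤ b n) (hsub : ∀ m n, b (m + n) ≤ b m * b n) (C : ℝ)
    (hC : 0 < C) (n : ℕ) (h : ∑ k ∈ Finset.range (n + 1), b k ≤ C * (n + 1)) :
    b n ≤ (2 * C) * (2 * C + 2 * C) := by
  by_contra hcon
  push Not at hcon
  have h1 : ∀ k ∈ Finset.range (n + 1), 2 * C < (b k + b (n - k)) := by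
    intro k hk
    by_contra hle
    push Not at hle
    have hk' : k ≤ n := by simpa [Nat.lt_succ_iff] using hk
    have := hsub k (n - k)
    rw [Nat.add_sub_cancel' hk'] at this
    nlinarith [hb k, hb (n - k)]
  have h2 := Finset.sum_lt_sum_of_nonempty (by simp) h1
  have h3 := Finset.sum_range_reflect b (n + 1)
  simp only [Nat.add_sub_cancel] at h3
  rw [Finset.sum_add_distrib, h3] at h2
  simp at h2
  linarith

/-- A positive operator whose peripheral eigenvalue is semisimple is power bounded. -/
lemma aux_pow (K : Set V) (hKcl : IsClosed K) (hKconv : Convex ℝ K)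
    (hKcone : ∀ c : ℝ, 0 ≤ c → ∀ x ∈ K, c • x ∈ K)
    (hKint : (interior K).Nonempty) (hKpt : K ∩ (-K) = {(0 : V)})
    (B : V →L[ℝ] V) (hB : ∀ x ∈ K, B x ∈ K)
    (h : ∀ x, B (B x - x) = B x - x → B x = x)
    (hsum : ∀ t : ℝ, 0 < t → t < 1 → Summable (fun n : ℕ => t ^ n • B ^ n)) :
    ∃ M : ℝ, ∀ᶠ n : ℕ in atTop, ‖B ^ n‖ ≤ M := by
  obtain ⟨f, e, heK, C₁, hC₁, hf⟩ := aux_norm K hKcl hKconv hKcone hKint hKpt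
  obtain ⟨C₂, hC₂⟩ := aux_abel B h
  have hBn : ∀ n : ℕ, ∀ x ∈ K, (B ^ n) x ∈ K := by
    intro n
    induction n with
    | zero => intro x hx; simpa using hx
    | succ n ih => intro x hx; rw [pow_succ]; exact ih _ (hB x hx)
  let D : ℝ := C₁ * (4 * (‖f‖ * (C₂ * ‖e‖)))
  let C : ℝ := |D| + 1
  have hC : 0 < C := by positivity
  let t : ℕ → ℝ := fun n => 1 - 1 / (2 * ((n:ℝ) + 1))
  have htlim : Tendsto t atTop (𝓝[<] 1) := by
    rw [tendsto_nhdsWithin_iff]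
    constructor
    · have h1 : Tendsto (fun n : ℕ => 1 - (1/2) * (1 / ((n:ℝ) + 1))) atTop (𝓝 (1 - (1/2) * 0)) :=
        (tendsto_one_div_add_atTop_nhds_zero_nat.const_mul _).const_sub _
      rw [mul_zero, sub_zero] at h1
      refine h1.congr ?_
      intro n
      simp only [t]
      field_simp
    · refine Eventually.of_forall fun n => ?_
      have : (0:ℝ) < 1 / (2 * ((n:ℝ) + 1)) := by positivity
      simp only [t, Set.mem_Iio]
      linarith
  refine ⟨(2 * C) * (2 * C + 2 * C), ?_⟩
  filter_upwards [htlim.eventually hC₂] with n hn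
  refine aux_markov (fun k => ‖B ^ k‖) (fun k => norm_nonneg _)
    (fun m k => by simp only [pow_add]; exact norm_mul_le _ _) C hC n ?_
  set τ := t n with hτ
  have hd : 1 - τ = 1 / (2 * ((n:ℝ) + 1)) := by simp [hτ, t]
  have hd0 : 0 < 1 - τ := by rw [hd]; positivity
  have hd1 : 1 - τ ≤ 1 / 2 := by
    rw [hd]
    apply one_div_le_one_div_of_le (by norm_num)
    have : (0:ℝ) ≤ n := n.cast_nonneg
    linarith
  have hτ0 : 0 < τ := by linarith
  have hτ1 : τ < 1 := by linarith
  have hS := hsum τ hτ0 hτ1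
  have hS' : Summable (fun k : ℕ => (τ • B) ^ k) := by simpa only [smul_pow] using hS
  have hinv := hn _ hS'.tsum_pow_mul_one_sub
  set S := ∑' k : ℕ, (τ • B) ^ k with hSdef
  have hHS : HasSum (fun k : ℕ => τ ^ k * f ((B ^ k) e)) (f (S e)) := by
    have h1 := hS'.hasSum
    have h2 := (f.comp (ContinuousLinearMap.apply ℝ V e)).hasSum h1
    simpa [hSdef, smul_pow] using h2
  have hpart : ∑ k ∈ Finset.range (n + 1), τ ^ k * f ((B ^ k) e) ≤ f (S e) :=
    sum_le_hasSum _ (fun k _ => mul_nonneg (by positivity) (hf _ (hBn k)).1) hHS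
  have hpow : ∀ k ∈ Finset.range (n + 1), (1/2 : ℝ) ≤ τ ^ k := by
    intro k hk
    have hk' : k ≤ n := by simpa [Nat.lt_succ_iff] using hk
    have h1 : τ ^ n ≤ τ ^ k := pow_le_pow_of_le_one hτ0.le hτ1.le hk'
    have h2 := one_add_mul_le_pow (a := -(1 - τ)) (by linarith) n
    have h3 : (1 + -(1 - τ)) = τ := by ring
    rw [h3, hd] at h2
    have h4 : (n:ℝ) * -(1 / (2 * ((n:ℝ) + 1))) ≥ -(1/2) := by
      have : (n:ℝ) * -(1 / (2 * ((n:ℝ) + 1))) = -(n / (2 * ((n:ℝ) + 1))) := by ring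
      rw [this]
      have : n / (2 * ((n:ℝ) + 1)) ≤ 1/2 := by
        rw [div_le_div_iff₀ (by positivity) (by norm_num)]
        linarith
      linarith
    linarith
  have hSe : f (S e) ≤ ‖f‖ * (C₂ * ‖e‖) * (2 * ((n:ℝ) + 1)) := by
    have h1 : f (((1 - τ) • S) e) ≤ ‖f‖ * (C₂ * ‖e‖) := by
      calc f (((1 - τ) • S) e) ≤ ‖f (((1 - τ) • S) e)‖ := le_abs_self _
        _ ≤ ‖f‖ * ‖((1 - τ) • S) e‖ := f.le_opNorm _
        _ ≤ ‖f‖ * (‖(1 - τ) • S‖ * ‖e‖) := by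
          gcongr
          exact ContinuousLinearMap.le_opNorm _ _
        _ ≤ ‖f‖ * (C₂ * ‖e‖) := by gcongr
    rw [ContinuousLinearMap.smul_apply, map_smul, smul_eq_mul, hd] at h1
    rw [one_div, inv_mul_le_iff₀ (by positivity)] at h1
    linarith
  calc ∑ k ∈ Finset.range (n + 1), ‖B ^ k‖
      ≤ ∑ k ∈ Finset.range (n + 1), C₁ * (2 * (τ ^ k * f ((B ^ k) e))) := by
        refine Finset.sum_le_sum fun k hk => (hf _ (hBn k)).2.trans ?_
        gcongr
        have := hpow k hk
        nlinarith [(hf _ (hBn k)).1]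
    _ = C₁ * (2 * ∑ k ∈ Finset.range (n + 1), τ ^ k * f ((B ^ k) e)) := by
        rw [Finset.mul_sum, Finset.mul_sum]
    _ ≤ C₁ * (2 * (‖f‖ * (C₂ * ‖e‖) * (2 * ((n:ℝ) + 1)))) := by gcongr; exact hpart.trans hSe
    _ = D * ((n:ℝ) + 1) := by simp only [D]; ring
    _ ≤ C * ((n:ℝ) + 1) := by
        gcongr
        simp only [C]
        linarith [le_abs_self D]

/-- Telescoping of Cesàro means. -/
lemma aux_tele (B : V →L[ℝ] V) (n : ℕ) (z : V) :
    ∑ k ∈ Finset.range n, (B ^ k) (B z - z) = (B ^ n) z - z := by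
  have := Finset.sum_range_sub (fun k => (B ^ k) z) n
  simp only [pow_zero, ContinuousLinearMap.one_apply] at this
  rw [← this]
  refine Finset.sum_congr rfl fun k _ => ?_
  rw [map_sub, pow_succ]
  rfl

lemma aux_fix (B : V →L[ℝ] V) (k : ℕ) (x : V) (hx : B x = x) : (B ^ k) x = x := by
  induction k with
  | zero => simp
  | succ k ih => rw [pow_succ, ContinuousLinearMap.mul_apply, hx, ih]

/-- Mean ergodic theorem in finite dimension. -/
lemma aux_mean (B : V →L[ℝ] V) (h : ∀ x, B (B x - x) = B x - x → B x = x)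
    (hM : ∃ M : ℝ, ∀ᶠ n : ℕ in atTop, ‖B ^ n‖ ≤ M) :
    ∃ P : V →L[ℝ] V, (∀ x, B (P x) = P x) ∧ (∀ x, B x = x → P x = x) ∧
      ∀ x, Tendsto (fun n : ℕ => (n : ℝ)⁻¹ • ∑ k ∈ Finset.range n, (B ^ k) x) atTop (𝓝 (P x)) := by
  obtain ⟨P, hP1, hP2, hP3⟩ := aux_proj B h
  obtain ⟨M, hM⟩ := hM
  refine ⟨P, hP1, hP2, ?_⟩
  intro x
  obtain ⟨z, hz⟩ := hP3 x
  have h0 : Tendsto (fun n : ℕ => (n : ℝ)⁻¹ • ((B ^ n) z - z)) atTop (𝓝 0) := by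
    refine squeeze_zero_norm' (a := fun n : ℕ => (n : ℝ)⁻¹ * (M * ‖z‖ + ‖z‖)) ?_ ?_
    · filter_upwards [hM] with n hn
      rw [norm_smul, Real.norm_of_nonneg (by positivity)]
      gcongr
      refine (norm_sub_le _ _).trans ?_
      gcongr
      exact ((B ^ n).le_opNorm z).trans (by gcongr)
    · simpa using (tendsto_inv_atTop_nhds_zero_nat (𝕜 := ℝ)).mul_const (M * ‖z‖ + ‖z‖)
  have h1 := h0.const_add (P x)
  rw [add_zero] at h1
  refine h1.congr' ?_
  filter_upwards [eventually_ge_atTop 1] with n hn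
  have hn0 : (n : ℝ) ≠ 0 := by positivity
  have h2 : ∀ k, (B ^ k) x = P x + (B ^ k) (B z - z) := by
    intro k
    conv_lhs => rw [hz]
    rw [map_add, aux_fix B k _ (hP1 x)]
  simp only [h2]
  rw [Finset.sum_add_distrib, aux_tele, smul_add]
  congr 1
  rw [Finset.sum_const, Finset.card_range, ← Nat.cast_smul_eq_nsmul ℝ, smul_smul,
    inv_mul_cancel₀ hn0, one_smul]

/-- (3) implies (1). -/
lemma aux_31 (K : Set V) (hKcl : IsClosed K) (hKconv : Convex ℝ K)
    (hKcone : ∀ c : ℝ, 0 ≤ c → ∀ x ∈ K, c • x ∈ K)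
    (hKint : (interior K).Nonempty) (hKpt : K ∩ (-K) = {(0 : V)})
    (A : V →L[ℝ] V) (hA : ∀ x ∈ K, A x ∈ K) (hr : 0 < specRad A)
    (hfr : Module.finrank ℝ ((Module.End.genEigenspace (A : V →ₗ[ℝ] V) (specRad A)) ⊤) = 1) :
    IsErgodic K A := by
  set r := specRad A with hrdef
  let L : Module.End ℝ V := (A : V →ₗ[ℝ] V) - r • 1
  have hL : ∀ x, L x = A x - r • x := fun x => rfl
  -- the generalized eigenspace is spanned by one eigenvector
  have hspan : ∃ w : V, w ≠ 0 ∧ L w = 0 ∧ ∀ x, (∃ k : ℕ, (L ^ k) x = 0) → ∃ c : ℝ, c • w = x := by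
    obtain ⟨⟨w, hw⟩, hw0, hws⟩ := finrank_eq_one_iff'.1 hfr
    have hw0' : w ≠ 0 := fun h => hw0 (Subtype.ext h)
    have hall : ∀ x, (∃ k : ℕ, (L ^ k) x = 0) → ∃ c : ℝ, c • w = x := by
      intro x hx
      obtain ⟨c, hc⟩ := hws ⟨x, Module.End.mem_genEigenspace_top.2 hx⟩
      exact ⟨c, congrArg Subtype.val hc⟩
    obtain ⟨k, hk⟩ := Module.End.mem_genEigenspace_top.1 hw
    have hk : (L ^ k) w = 0 := hk
    refine ⟨w, hw0', ?_, hall⟩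
    obtain ⟨c, hc⟩ := hall (L w) ⟨k, by
      rw [← Module.End.mul_apply, ← pow_succ, pow_succ', Module.End.mul_apply, hk, map_zero]⟩
    have hck : ∀ j : ℕ, (L ^ j) w = c ^ j • w := by
      intro j
      induction j with
      | zero => simp
      | succ j ih => rw [pow_succ', Module.End.mul_apply, ih, map_smul, ← hc, smul_smul, pow_succ]
    rw [hck k] at hk
    have hc0 : c = 0 := by
      exact eq_zero_of_pow_eq_zero ((smul_eq_zero.1 hk).resolve_right hw0')
    rw [← hc, hc0, zero_smul]
  obtain ⟨w, hw0, hLw, hall⟩ := hspan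
  let B : V →L[ℝ] V := r⁻¹ • A
  have hBdef : ∀ x, B x = r⁻¹ • A x := fun x => rfl
  have hBL : ∀ x, B x - x = r⁻¹ • L x := by
    intro x
    rw [hBdef, hL, smul_sub, smul_smul, inv_mul_cancel₀ hr.ne', one_smul]
  have hri : r⁻¹ ≠ 0 := inv_ne_zero hr.ne'
  have hBfix : ∀ x, B x = x ↔ L x = 0 := by
    intro x
    rw [← sub_eq_zero, hBL, smul_eq_zero]
    simp [hri]
  have hBK : ∀ x ∈ K, B x ∈ K := fun x hx => hKcone _ (inv_nonneg.2 hr.le) _ (hA x hx)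
  have hss : ∀ x, B (B x - x) = B x - x → B x = x := by
    intro x hx
    rw [hBfix, hBL, map_smul, smul_eq_zero] at hx
    have hx := hx.resolve_left hri
    obtain ⟨c, hc⟩ := hall x ⟨2, by rw [pow_two]; exact hx⟩
    rw [hBfix, ← hc, map_smul, hLw, smul_zero]
  have hsum : ∀ t : ℝ, 0 < t → t < 1 → Summable (fun n : ℕ => t ^ n • B ^ n) :=
    fun t h0 h1 => aux_summable A hr t h0 h1
  obtain ⟨P, hP1, hP2, hP3⟩ :=
    aux_mean B hss (aux_pow K hKcl hKconv hKcone hKint hKpt B hBK hss hsum)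
  have hBn : ∀ n : ℕ, ∀ x ∈ K, (B ^ n) x ∈ K := by
    intro n
    induction n with
    | zero => intro x hx; simpa using hx
    | succ n ih => intro x hx; rw [pow_succ]; exact ih _ (hBK x hx)
  have hadd : ∀ x ∈ K, ∀ y ∈ K, x + y ∈ K := by
    intro x hx y hy
    have h1 := hKconv hx hy (a := 1/2) (b := 1/2) (by norm_num) (by norm_num) (by norm_num)
    have h2 := hKcone 2 (by norm_num) _ h1
    rw [smul_add, smul_smul, smul_smul] at h2
    norm_num at h2
    exact h2
  have hK0 : (0 : V) ∈ K := by
    obtain ⟨e, he⟩ := hKint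
    simpa using hKcone 0 le_rfl e (interior_subset he)
  have hPK : ∀ x ∈ K, P x ∈ K := by
    intro x hx
    refine hKcl.mem_of_tendsto (hP3 x) (Eventually.of_forall fun n => ?_)
    refine hKcone _ (by positivity) _ ?_
    exact Finset.sum_induction _ (· ∈ K) (fun a b ha hb => hadd a ha b hb) hK0
      (fun k _ => hBn k x hx)
  have hex : ∃ x ∈ K, P x ≠ 0 := by
    by_contra hcon
    push Not at hcon
    obtain ⟨e, he⟩ := hKint
    obtain ⟨ε, hε, hball⟩ :=
      Metric.nhds_basis_closedBall.mem_iff.1 (mem_interior_iff_mem_nhds.1 he)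
    have hwn : 0 < ‖w‖ := norm_pos_iff.2 hw0
    have h1 : P (e + (ε * ‖w‖⁻¹) • w) = 0 := hcon _ (hball (by
      rw [mem_closedBall_iff_norm, add_sub_cancel_left, norm_smul,
        Real.norm_of_nonneg (by positivity)]
      field_simp; rfl))
    rw [map_add, hcon e (interior_subset he), zero_add, map_smul,
      hP2 w ((hBfix w).2 hLw), smul_eq_zero] at h1
    rcases h1 with h1 | h1
    · have : ε * ‖w‖⁻¹ ≠ 0 := by positivity
      exact this h1
    · exact hw0 h1
  obtain ⟨q, hqK, hq⟩ := hex
  set x₀ := P q with hx₀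
  have hx₀K : x₀ ∈ K := hPK q hqK
  have hPx₀ : P x₀ = x₀ := hP2 _ (hP1 q)
  have hmul : ∀ x, ∃ c : ℝ, P x = c • x₀ := by
    intro x
    have hk : ∀ x, ∃ c : ℝ, c • w = P x := fun x =>
      hall (P x) ⟨1, by rw [pow_one]; exact (hBfix _).1 (hP1 x)⟩
    obtain ⟨c, hc⟩ := hk x
    obtain ⟨d, hd⟩ := hk q
    have hd0 : d ≠ 0 := by
      rintro rfl
      exact hq (by rw [hx₀, ← hd, zero_smul])
    refine ⟨c * d⁻¹, ?_⟩
    rw [hx₀, ← hd, ← hc, smul_smul, mul_assoc, inv_mul_cancel₀ hd0, mul_one]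
  let y₀ : V := (⟪x₀, x₀⟫)⁻¹ • ContinuousLinearMap.adjoint P x₀
  have hn : ⟪x₀, x₀⟫ ≠ 0 := inner_self_ne_zero.2 hq
  have hy : ∀ x, P x = ⟪y₀, x⟫ • x₀ := by
    intro x
    obtain ⟨c, hc⟩ := hmul x
    have : ⟪y₀, x⟫ = c := by
      simp only [y₀]
      rw [real_inner_smul_left, ContinuousLinearMap.adjoint_inner_left, hc, real_inner_smul_right,
        mul_comm c, ← mul_assoc, inv_mul_cancel₀ hn, one_mul]
    rw [this, hc]
  refine ⟨x₀, y₀, hr, hx₀K, ?_, ?_, ?_⟩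
  · intro x hx
    by_contra hneg
    push Not at hneg
    have h1 := hPK x hx
    rw [hy x] at h1
    have h2 := hKcone (-⟪y₀, x⟫)⁻¹ (inv_nonneg.2 (by linarith)) _ h1
    rw [smul_smul, inv_neg, neg_mul, inv_mul_cancel₀ hneg.ne, neg_one_smul] at h2
    have h3 : x₀ ∈ K ∩ (-K) := ⟨hx₀K, by simpa using h2⟩
    rw [hKpt] at h3
    exact hq (by simpa using h3)
  · have h1 := hy x₀
    rw [hPx₀] at h1
    have h2 : (⟪y₀, x₀⟫ - 1) • x₀ = 0 := by rw [sub_smul, one_smul, ← h1, sub_self]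
    have := (smul_eq_zero.1 h2).resolve_right hq
    linarith
  · intro x
    rw [← hy x]
    exact hP3 x

/-- (1) implies (2). -/
lemma aux_12 (K : Set V) (A : V →L[ℝ] V) (h : IsErgodic K A) :
    (0 < specRad A ∧
        Module.finrank ℝ (Module.End.eigenspace (A : V →ₗ[ℝ] V) (specRad A)) = 1 ∧
        ∃ x₀ ∈ K, ∃ y₀ ∈ dualSet K, x₀ ≠ 0 ∧ y₀ ≠ 0 ∧
          A x₀ = specRad A • x₀ ∧
          ContinuousLinearMap.adjoint A y₀ = specRad A • y₀ ∧ ⟪y₀, x₀⟫ = 1) := by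
  obtain ⟨x₀, y₀, hr, hx₀, hy₀, hxy, hlim⟩ := h
  set r := specRad A with hrdef
  let B : V →L[ℝ] V := r⁻¹ • A
  have hBdef : ∀ x, B x = r⁻¹ • A x := fun x => rfl
  have hx0 : x₀ ≠ 0 := by rintro rfl; simp at hxy
  have hy0 : y₀ ≠ 0 := by rintro rfl; simp at hxy
  have hlim : ∀ x : V, Tendsto (fun n : ℕ => (n : ℝ)⁻¹ • ∑ k ∈ Finset.range n, (B ^ k) x)
      atTop (𝓝 (⟪y₀, x⟫ • x₀)) := hlim
  -- the means of `B z - z` tend to zero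
  have hz : ∀ z : V, Tendsto (fun n : ℕ => (n : ℝ)⁻¹ • ((B ^ n) z - z)) atTop (𝓝 0) := by
    intro z
    have h1 := (hlim z).comp (tendsto_add_atTop_nat 1)
    have h2 : Tendsto (fun n : ℕ => ((n : ℝ) + 1) / n) atTop (𝓝 1) := by
      have h3 : Tendsto (fun n : ℕ => 1 + (n:ℝ)⁻¹) atTop (𝓝 (1 + 0)) :=
        tendsto_inv_atTop_nhds_zero_nat.const_add 1
      rw [add_zero] at h3
      refine h3.congr' ?_
      filter_upwards [eventually_ge_atTop 1] with n hn
      have hn0 : (n : ℝ) ≠ 0 := by positivity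
      field_simp
    have h3 := ((h2.smul h1).sub (hlim z)).sub
      ((tendsto_inv_atTop_nhds_zero_nat (𝕜 := ℝ)).smul_const z)
    rw [one_smul, sub_self, zero_smul, sub_zero] at h3
    refine h3.congr' ?_
    filter_upwards [eventually_ge_atTop 1] with n hn
    have hn0 : (n : ℝ) ≠ 0 := by positivity
    have hn1 : (n : ℝ) + 1 ≠ 0 := by positivity
    simp only [Function.comp, Nat.cast_add, Nat.cast_one]
    rw [smul_smul, Finset.sum_range_succ,
      show ((n:ℝ) + 1) / n * ((n:ℝ) + 1)⁻¹ = (n:ℝ)⁻¹ by field_simp, smul_add, add_sub_cancel_left,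
      smul_sub]
  have hyz : ∀ z : V, ⟪y₀, B z - z⟫ = 0 := by
    intro z
    have h1 := hlim (B z - z)
    simp only [aux_tele] at h1
    have h2 := tendsto_nhds_unique h1 (hz z)
    exact (smul_eq_zero.1 h2).resolve_right hx0
  have hBx : B x₀ = x₀ := by
    have h1 := hlim x₀
    rw [hxy, one_smul] at h1
    have h2 := ((B.continuous.tendsto x₀).comp h1).sub h1
    have h3 := tendsto_nhds_unique (h2.congr (fun n => ?_)) (hz x₀)
    · exact sub_eq_zero.1 h3
    · simp only [Function.comp]
      rw [map_smul, ← smul_sub, map_sum, ← Finset.sum_sub_distrib, ← aux_tele]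
      congr 1
      refine Finset.sum_congr rfl fun k _ => ?_
      rw [map_sub, ← ContinuousLinearMap.mul_apply, ← ContinuousLinearMap.mul_apply, ← pow_succ,
        ← pow_succ']
  have hBA : ∀ x, A x = r • B x := by
    intro x
    rw [hBdef, smul_smul, mul_inv_cancel₀ hr.ne', one_smul]
  have hAx : A x₀ = r • x₀ := by rw [hBA, hBx]
  refine ⟨hr, ?_, x₀, hx₀, y₀, hy₀, hx0, hy0, hAx, ?_, hxy⟩
  · rw [finrank_eq_one_iff']
    refine ⟨⟨x₀, Module.End.mem_eigenspace_iff.2 hAx⟩, fun h => hx0 (congrArg Subtype.val h), ?_⟩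
    rintro ⟨x, hx⟩
    have hx : A x = r • x := Module.End.mem_eigenspace_iff.1 hx
    have hBx' : B x = x := by rw [hBdef, hx, smul_smul, inv_mul_cancel₀ hr.ne', one_smul]
    refine ⟨⟪y₀, x⟫, Subtype.ext ?_⟩
    refine tendsto_nhds_unique (hlim x) ?_
    refine tendsto_const_nhds.congr' ?_
    filter_upwards [eventually_ge_atTop 1] with n hn
    have hn0 : (n : ℝ) ≠ 0 := by positivity
    simp only [aux_fix B _ x hBx']
    rw [Finset.sum_const, Finset.card_range, ← Nat.cast_smul_eq_nsmul ℝ, smul_smul,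
      inv_mul_cancel₀ hn0, one_smul]
  · refine ext_inner_right ℝ fun v => ?_
    rw [ContinuousLinearMap.adjoint_inner_left, hBA, real_inner_smul_left, real_inner_smul_right]
    have := hyz v
    rw [inner_sub_right, sub_eq_zero] at this
    rw [this]

/-- (2) implies (3). -/
lemma aux_23 (A : V →L[ℝ] V) (r : ℝ)
    (hfr : Module.finrank ℝ (Module.End.eigenspace (A : V →ₗ[ℝ] V) r) = 1)
    (x₀ y₀ : V) (hx0 : x₀ ≠ 0) (hAx : A x₀ = r • x₀)
    (hAy : ContinuousLinearMap.adjoint A y₀ = r • y₀) (hxy : ⟪y₀, x₀⟫ = 1) :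
    Module.finrank ℝ ((Module.End.genEigenspace (A : V →ₗ[ℝ] V) r) ⊤) = 1 := by
  let L : Module.End ℝ V := (A : V →ₗ[ℝ] V) - r • 1
  have hL : ∀ x, L x = A x - r • x := fun x => rfl
  have hLx : L x₀ = 0 := by rw [hL, hAx, sub_self]
  have hyL : ∀ x, ⟪y₀, L x⟫ = 0 := by
    intro x
    rw [hL, inner_sub_right, ← ContinuousLinearMap.adjoint_inner_left, hAy, real_inner_smul_left,
      real_inner_smul_right, sub_self]
  have hker : ∀ x, L x = 0 → ∃ c : ℝ, c • x₀ = x := by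
    intro x hx
    have hm : ∀ x, L x = 0 → x ∈ Module.End.eigenspace (A : V →ₗ[ℝ] V) r := by
      intro x hx
      rw [hL, sub_eq_zero] at hx
      exact Module.End.mem_eigenspace_iff.2 hx
    obtain ⟨c, hc⟩ := (finrank_eq_one_iff_of_nonzero' (⟨x₀, hm _ hLx⟩ :
      Module.End.eigenspace (A : V →ₗ[ℝ] V) r) (fun h => hx0 (congrArg Subtype.val h))).1 hfr
      ⟨x, hm x hx⟩
    exact ⟨c, congrArg Subtype.val hc⟩
  have hk1 : ∀ k : ℕ, ∀ x, (L ^ k) x = 0 → L x = 0 := by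
    intro k
    induction k with
    | zero => intro x hx; have : x = 0 := by simpa using hx
              rw [this, map_zero]
    | succ k ih =>
      intro x hx
      rw [pow_succ, Module.End.mul_apply] at hx
      obtain ⟨c, hc⟩ := hker _ (ih _ hx)
      have := hyL x
      rw [← hc, real_inner_smul_right, hxy, mul_one] at this
      rw [← hc, this, zero_smul]
  rw [finrank_eq_one_iff']
  refine ⟨⟨x₀, Module.End.mem_genEigenspace_top.2 ⟨1, by rw [pow_one]; exact hLx⟩⟩,
    fun h => hx0 (congrArg Subtype.val h), ?_⟩
  rintro ⟨x, hx⟩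
  obtain ⟨k, hk⟩ := Module.End.mem_genEigenspace_top.1 hx
  obtain ⟨c, hc⟩ := hker x (hk1 k x hk)
  exact ⟨c, Subtype.ext hc⟩

theorem stmt_4 (K : Set V) (hKcl : IsClosed K) (hKconv : Convex ℝ K)
    (hKcone : ∀ c : ℝ, 0 ≤ c → ∀ x ∈ K, c • x ∈ K)
    (hKint : (interior K).Nonempty) (hKpt : K ∩ (-K) = {(0 : V)})
    (A : V →L[ℝ] V) (hA : ∀ x ∈ K, A x ∈ K) :
    (IsErgodic K A ↔
      (0 < specRad A ∧
        Module.finrank ℝ (Module.End.eigenspace (A : V →ₗ[ℝ] V) (specRad A)) = 1 ∧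
        ∃ x₀ ∈ K, ∃ y₀ ∈ dualSet K, x₀ ≠ 0 ∧ y₀ ≠ 0 ∧
          A x₀ = specRad A • x₀ ∧
          ContinuousLinearMap.adjoint A y₀ = specRad A • y₀ ∧ ⟪y₀, x₀⟫ = 1)) ∧
    (IsErgodic K A ↔
      (0 < specRad A ∧
        Module.finrank ℝ ((Module.End.genEigenspace (A : V →ₗ[ℝ] V) (specRad A)) ⊤) = 1)) := by
  have h31 := aux_31 K hKcl hKconv hKcone hKint hKpt A hA
  have h12 := aux_12 K A
  refine ⟨⟨h12, ?_⟩, ⟨fun h => ?_, fun h => h31 h.1 h.2⟩⟩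
  · rintro ⟨hr, hfr, x₀, -, y₀, -, hx0, -, hAx, hAy, hxy⟩
    exact h31 hr (aux_23 A _ hfr x₀ y₀ hx0 hAx hAy hxy)
  · obtain ⟨hr, hfr, x₀, -, y₀, -, hx0, -, hAx, hAy, hxy⟩ := h12 h
    exact ⟨hr, aux_23 A _ hfr x₀ y₀ hx0 hAx hAy hxy⟩
end

section
/- For a K-positive map A, A is K-mixing if and only if r(A) > 0 and the eigenvalue r(A)² of A⊗A has geometric multiplicity 1. -/
open Filter Topology RealInnerProductSpace

variable {V : Type*} [NormedAddCommGroup V] [InnerProductSpace ℝ V] [FiniteDimensional ℝ V]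

variable {W : Type*} [NormedAddCommGroup W] [InnerProductSpace ℝ W] [FiniteDimensional ℝ W]

/-- The tensor product cone inside the (abstract) tensor square `W` of `V`. -/
def tensorCone (tmul : V →ₗ[ℝ] V →ₗ[ℝ] W) (K₁ K₂ : Set V) : Set W :=
  {z | ∃ (n : ℕ) (f g : Fin n → V),
    (∀ i, f i ∈ K₁) ∧ (∀ i, g i ∈ K₂) ∧ z = ∑ i, tmul (f i) (g i)}

section Analytic

def EigPair (X : V →L[ℝ] V) (p q : ℝ) (a b : V) : Prop :=
  (a ≠ 0 ∨ b ≠ 0) ∧ X a = p • a - q • b ∧ X b = p • b + q • a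

attribute [local instance] Matrix.linftyOpNormedRing Matrix.linftyOpNormedAlgebra

abbrev Idx (V : Type*) [NormedAddCommGroup V] [InnerProductSpace ℝ V] [FiniteDimensional ℝ V] :=
  Fin (Module.finrank ℝ V)

noncomputable def bas (V : Type*) [NormedAddCommGroup V] [InnerProductSpace ℝ V]
    [FiniteDimensional ℝ V] : Module.Basis (Idx V) ℝ V := Module.finBasis ℝ V

noncomputable def phi (V : Type*) [NormedAddCommGroup V] [InnerProductSpace ℝ V]
    [FiniteDimensional ℝ V] : (V →L[ℝ] V) →+* Matrix (Idx V) (Idx V) ℂ :=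
  (Complex.ofRealHom.mapMatrix).comp
    (((LinearMap.toMatrixAlgEquiv (bas V)).toRingEquiv.toRingHom).comp
      ContinuousLinearMap.toLinearMapRingHom)

lemma phi_apply (X : V →L[ℝ] V) (i j : Idx V) :
    phi V X i j = (((bas V).repr (X (bas V j)) i : ℝ) : ℂ) := by
  simp [phi, LinearMap.toMatrixAlgEquiv_apply]

noncomputable def phiL (V : Type*) [NormedAddCommGroup V] [InnerProductSpace ℝ V]
    [FiniteDimensional ℝ V] : (V →L[ℝ] V) →ₗ[ℝ] Matrix (Idx V) (Idx V) ℂ where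
  toFun := phi V
  map_add' := map_add _
  map_smul' c X := by
    ext i j
    simp [phi_apply]

lemma phiL_inj : LinearMap.ker (phiL V) = ⊥ := by
  rw [LinearMap.ker_eq_bot']
  intro X hX
  have h : ∀ i j, phi V X i j = 0 := fun i j => by
    have : phi V X = 0 := hX
    simp [this]
  apply ContinuousLinearMap.coe_injective
  apply (bas V).ext
  intro j
  apply (bas V).repr.injective
  ext i
  have := h i j
  rw [phi_apply] at this
  simpa using this

lemma phi_bounds : ∃ c C : ℝ, 0 < c ∧ 0 < C ∧ ∀ X : V →L[ℝ] V,
    ‖X‖ ≤ C * ‖phi V X‖ ∧ c * ‖phi V X‖ ≤ ‖X‖ := by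
  obtain ⟨k, hk, h⟩ := LinearMap.exists_antilipschitzWith (phiL V) phiL_inj
  obtain ⟨M, hM, h2⟩ := (LinearMap.toContinuousLinearMap (phiL V)).bound
  refine ⟨M⁻¹, k, by positivity, by exact_mod_cast hk, fun X => ⟨?_, ?_⟩⟩
  · have := h.le_mul_dist X 0
    simpa [phiL, dist_eq_norm] using this
  · have := h2 X
    rw [inv_mul_le_iff₀ hM]
    exact this

lemma phi_mulVec (X : V →L[ℝ] V) (v : Idx V → ℂ) (i : Idx V) :
    ((phi V X).mulVec v) i =
      ((bas V).repr (X (∑ j, (v j).re • bas V j)) i : ℂ) +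
      ((bas V).repr (X (∑ j, (v j).im • bas V j)) i : ℂ) * Complex.I := by
  simp only [Matrix.mulVec, dotProduct, phi_apply, map_sum, map_smul, Finsupp.coe_finsetSum,
    Finset.sum_apply, Finsupp.smul_apply, smul_eq_mul, Complex.ofReal_sum, Finset.sum_mul,
    ← Finset.sum_add_distrib]
  refine Finset.sum_congr rfl fun j _ => ?_
  conv_lhs => rw [← Complex.re_add_im (v j)]
  push_cast
  ring

lemma repr_sum (f : Idx V → ℝ) (i : Idx V) : (bas V).repr (∑ j, f j • bas V j) i = f i := by
  simp [Finsupp.single_apply]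

lemma mem_spec_iff (X : V →L[ℝ] V) (z : ℂ) :
    z ∈ spectrum ℂ (phi V X) ↔ ∃ a b, EigPair X z.re z.im a b := by
  rw [← Matrix.spectrum_toLin', ← Module.End.hasEigenvalue_iff_mem_spectrum]
  constructor
  · intro h
    obtain ⟨v, hv⟩ := h.exists_hasEigenvector
    have h1 := hv.apply_eq_smul
    rw [Matrix.toLin'_apply] at h1
    refine ⟨∑ j, (v j).re • bas V j, ∑ j, (v j).im • bas V j, ?_, ?_, ?_⟩
    · by_contra! hc
      apply hv.2
      ext i
      apply Complex.ext
      · rw [← repr_sum (fun j => (v j).re) i, hc.1]; simp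
      · rw [← repr_sum (fun j => (v j).im) i, hc.2]; simp
    · apply (bas V).repr.injective
      ext i
      have h2 := congrArg Complex.re (congrFun h1 i)
      rw [phi_mulVec] at h2
      simp only [map_sub, map_smul, Finsupp.sub_apply, Finsupp.smul_apply, repr_sum]
      simpa using h2
    · apply (bas V).repr.injective
      ext i
      have h2 := congrArg Complex.im (congrFun h1 i)
      rw [phi_mulVec] at h2
      simp only [map_add, map_smul, Finsupp.add_apply, Finsupp.smul_apply, repr_sum]
      simpa using h2
  · rintro ⟨a, b, h0, h1, h2⟩
    have ha := (bas V).sum_repr a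
    have hb := (bas V).sum_repr b
    apply Module.End.hasEigenvalue_of_hasEigenvector
      (x := fun i => ⟨(bas V).repr a i, (bas V).repr b i⟩)
    rw [Module.End.hasEigenvector_iff, Module.End.mem_eigenspace_iff, Matrix.toLin'_apply]
    constructor
    · ext i
      rw [phi_mulVec]
      simp only [ha, hb, h1, h2]
      apply Complex.ext <;> simp
    · intro hc
      have hc' := fun i => congrFun hc i
      have e1 : a = 0 := by
        apply (bas V).repr.injective
        ext i
        simpa using congrArg Complex.re (hc' i)
      have e2 : b = 0 := by
        apply (bas V).repr.injective
        ext i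
        simpa using congrArg Complex.im (hc' i)
      tauto

lemma cs : CompleteSpace (Matrix (Idx V) (Idx V) ℂ) := FiniteDimensional.complete ℂ _

lemma rad_ne_top (M : Matrix (Idx V) (Idx V) ℂ) [Nonempty (Idx V)] : spectralRadius ℂ M ≠ ⊤ := by
  have : CompleteSpace (Matrix (Idx V) (Idx V) ℂ) := cs
  obtain ⟨z, _, h⟩ := spectrum.exists_nnnorm_eq_spectralRadius M
  rw [← h]; simp

lemma gelf (M : Matrix (Idx V) (Idx V) ℂ) [Nonempty (Idx V)] :
    Tendsto (fun n : ℕ => ‖M ^ n‖ ^ ((n : ℝ)⁻¹)) atTop (𝓝 (spectralRadius ℂ M).toReal) := by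
  have : CompleteSpace (Matrix (Idx V) (Idx V) ℂ) := cs
  have h := spectrum.pow_norm_pow_one_div_tendsto_nhds_spectralRadius M
  have h2 := (ENNReal.tendsto_toReal (rad_ne_top M)).comp h
  refine h2.congr fun n => ?_
  simp only [Function.comp, one_div]
  rw [ENNReal.toReal_ofReal (by positivity)]

lemma const_root (c : ℝ) (hc : 0 < c) :
    Tendsto (fun n : ℕ => c ^ ((n : ℝ)⁻¹)) atTop (𝓝 1) := by
  have h1 : Tendsto (fun n : ℕ => ((n : ℝ)⁻¹)) atTop (𝓝 0) := tendsto_inv_atTop_nhds_zero_nat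
  have := (tendsto_const_nhds (x := c)).rpow h1 (Or.inl hc.ne')
  simpa using this

lemma specRad_eq [Nonempty (Idx V)] (X : V →L[ℝ] V) :
    specRad X = (spectralRadius ℂ (phi V X)).toReal := by
  obtain ⟨c, C, hc, hC, h⟩ := phi_bounds (V := V)
  have hg := gelf (phi V X)
  apply Tendsto.limsup_eq
  have h1 := (const_root c hc).mul hg
  have h2 := (const_root C hC).mul hg
  rw [one_mul] at h1 h2
  refine tendsto_of_tendsto_of_tendsto_of_le_of_le h1 h2 (fun n => ?_) (fun n => ?_)
  · simp only
    rw [← Real.mul_rpow hc.le (norm_nonneg _), ← map_pow]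
    exact Real.rpow_le_rpow (by positivity) (h _).2 (by positivity)
  · simp only
    rw [← Real.mul_rpow hC.le (norm_nonneg _), ← map_pow]
    exact Real.rpow_le_rpow (by positivity) (h _).1 (by positivity)

lemma nonempty_idx [Nontrivial V] : Nonempty (Idx V) :=
  ⟨⟨0, Module.finrank_pos⟩⟩

lemma spec_exists [Nontrivial V] (X : V →L[ℝ] V) :
    ∃ p q a b, EigPair X p q a b ∧ p ^ 2 + q ^ 2 = specRad X ^ 2 := by
  have := nonempty_idx (V := V)
  have : CompleteSpace (Matrix (Idx V) (Idx V) ℂ) := cs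
  obtain ⟨z, hz, h⟩ := spectrum.exists_nnnorm_eq_spectralRadius (phi V X)
  obtain ⟨a, b, hab⟩ := (mem_spec_iff X z).1 hz
  refine ⟨_, _, a, b, hab, ?_⟩
  rw [specRad_eq, ← h]
  simp [Complex.sq_norm, Complex.normSq_apply]
  ring

lemma spec_le [Nontrivial V] (X : V →L[ℝ] V) {p q : ℝ} {a b : V} (h : EigPair X p q a b) :
    p ^ 2 + q ^ 2 ≤ specRad X ^ 2 := by
  have := nonempty_idx (V := V)
  have hz := (mem_spec_iff X ⟨p, q⟩).2 ⟨a, b, h⟩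
  have h1 : (‖(⟨p, q⟩ : ℂ)‖₊ : ENNReal) ≤ spectralRadius ℂ (phi V X) :=
    le_iSup₂ (α := ENNReal) (f := fun k (_ : k ∈ spectrum ℂ (phi V X)) => (‖k‖₊ : ENNReal)) _ hz
  have h2 := ENNReal.toReal_mono (rad_ne_top _) h1
  rw [← specRad_eq] at h2
  simp only [ENNReal.coe_toReal, coe_nnnorm] at h2
  have h3 := pow_le_pow_left₀ (norm_nonneg _) h2 2
  rw [Complex.sq_norm, Complex.normSq_apply] at h3
  simp only at h3
  linarith

lemma pow_tendsto [Nontrivial V] (X : V →L[ℝ] V)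
    (h : ∀ p q a b, EigPair X p q a b → p ^ 2 + q ^ 2 < 1) :
    Tendsto (fun n : ℕ => X ^ n) atTop (𝓝 0) := by
  obtain ⟨p, q, a, b, hab, e⟩ := spec_exists X
  have := nonempty_idx (V := V)
  have h1 := h _ _ _ _ hab
  have hs : specRad X < 1 := by
    by_contra! hc
    nlinarith
  obtain ⟨c, C, hc, hC, hb⟩ := phi_bounds (V := V)
  have hg := gelf (phi V X)
  rw [← specRad_eq] at hg
  obtain ⟨t, ht1, ht2⟩ := exists_between (max_lt hs one_pos)
  have ht0 : 0 < t := lt_of_le_of_lt (le_max_right _ _) ht1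
  have hev := hg.eventually (gt_mem_nhds (lt_of_le_of_lt (le_max_left _ _) ht1))
  rw [tendsto_zero_iff_norm_tendsto_zero]
  have hlim : Tendsto (fun n : ℕ => C * t ^ n) atTop (𝓝 0) := by
    simpa using (tendsto_pow_atTop_nhds_zero_of_lt_one ht0.le ht2).const_mul C
  refine squeeze_zero' (Eventually.of_forall fun n => norm_nonneg _) ?_ hlim
  filter_upwards [hev, eventually_gt_atTop 0] with n hn hn0
  refine (hb _).1.trans ?_
  gcongr
  rw [map_pow]
  have := pow_le_pow_left₀ (by positivity) hn.le n
  rwa [Real.rpow_inv_natCast_pow (norm_nonneg _) hn0.ne'] at this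

end Analytic

section Algebraic

set_option linter.unusedSectionVars false

variable {tmul : V →ₗ[ℝ] V →ₗ[ℝ] W} {T : V →L[ℝ] V} {C : W →ₗ[ℝ] W}

lemma tmul_comm_dep (hinner : ∀ a c b d : V, ⟪tmul a b, tmul c d⟫ = ⟪a, c⟫ * ⟪b, d⟫)
    {a b : V} (h : tmul a b = tmul b a) : ⟪a, a⟫ • b = ⟪b, a⟫ • a := by
  apply ext_inner_right ℝ
  intro x
  have h1 := congrArg (fun z => ⟪z, tmul a x⟫) h
  simp only [hinner] at h1
  simp only [real_inner_smul_left]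
  linarith

lemma antisymm_zero (hinner : ∀ a c b d : V, ⟪tmul a b, tmul c d⟫ = ⟪a, c⟫ * ⟪b, d⟫)
    (H : ∀ z w, C z = z → C w = w → z ≠ 0 → ∃ c : ℝ, w = c • z) {a b a' b' : V}
    (h1 : C (tmul a' a' + tmul b' b') = tmul a' a' + tmul b' b')
    (h2 : C (tmul a b - tmul b a) = tmul a b - tmul b a)
    (h0 : a' ≠ 0 ∨ b' ≠ 0) : tmul a b = tmul b a := by
  have hz : tmul a' a' + tmul b' b' ≠ 0 := by
    intro hz
    have e := congrArg (fun z => ⟪z, tmul a' a' + tmul b' b'⟫) hz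
    simp only [inner_add_left, inner_add_right, hinner, inner_zero_left] at e
    rw [real_inner_comm a' b'] at e
    have e1 : 0 ≤ ⟪a', a'⟫ := real_inner_self_nonneg
    have e2 : 0 ≤ ⟪b', b'⟫ := real_inner_self_nonneg
    rcases h0 with h0 | h0
    · have : 0 < ⟪a', a'⟫ := real_inner_self_pos.2 h0
      nlinarith [mul_self_nonneg ⟪a', b'⟫, mul_self_nonneg ⟪b', b'⟫, mul_self_nonneg ⟪b', a'⟫, mul_pos this this]
    · have : 0 < ⟪b', b'⟫ := real_inner_self_pos.2 h0
      nlinarith [mul_self_nonneg ⟪a', b'⟫, mul_self_nonneg ⟪a', a'⟫, mul_self_nonneg ⟪b', a'⟫, mul_pos this this]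
  obtain ⟨c, hc⟩ := H _ _ h1 h2 hz
  have e : ⟪tmul a b - tmul b a, tmul a b - tmul b a⟫ = 0 := by
    conv_lhs => rw [hc]
    rw [hc.symm, hc]
    conv_lhs => arg 3; rw [← hc]
    simp only [inner_add_left, inner_sub_right, hinner, real_inner_smul_left]
    ring
  exact sub_eq_zero.1 (inner_self_eq_zero.1 e)

lemma pair_real (hinner : ∀ a c b d : V, ⟪tmul a b, tmul c d⟫ = ⟪a, c⟫ * ⟪b, d⟫)
    (hC : ∀ a b, C (tmul a b) = tmul (T a) (T b))
    (H : ∀ z w, C z = z → C w = w → z ≠ 0 → ∃ c : ℝ, w = c • z) {p q : ℝ} {a b : V}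
    (h : EigPair T p q a b) (hpq : p ^ 2 + q ^ 2 = 1) : q = 0 := by
  obtain ⟨h0, ha, hb⟩ := h
  have h1 : C (tmul a a + tmul b b) = tmul a a + tmul b b := by
    have : tmul a a + tmul b b = (p ^ 2 + q ^ 2) • (tmul a a + tmul b b) := by rw [hpq, one_smul]
    conv_rhs => rw [this]
    simp only [map_add, map_smul, hC, ha, hb, map_sub, LinearMap.add_apply, LinearMap.sub_apply,
      LinearMap.smul_apply]
    module
  have h2 : C (tmul a b - tmul b a) = tmul a b - tmul b a := by
    have : tmul a b - tmul b a = (p ^ 2 + q ^ 2) • (tmul a b - tmul b a) := by rw [hpq, one_smul]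
    conv_rhs => rw [this]
    simp only [map_add, map_smul, hC, ha, hb, map_sub, LinearMap.add_apply, LinearMap.sub_apply,
      LinearMap.smul_apply]
    module
  have h3 := antisymm_zero hinner H h1 h2 h0
  have d1 := tmul_comm_dep hinner h3
  by_cases ha0 : a = 0
  · subst ha0
    have : q • b = 0 := by simpa using ha
    rcases smul_eq_zero.1 this with h | h
    · exact h
    · simp_all
  · have hn : ⟪a, a⟫ ≠ 0 := fun h => ha0 (inner_self_eq_zero.1 h)
    set s := ⟪a, a⟫⁻¹ * ⟪b, a⟫ with hs
    have hbs : b = s • a := by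
      rw [hs, mul_smul, ← d1, smul_smul, inv_mul_cancel₀ hn, one_smul]
    rw [hbs, map_smul, ha, hbs] at hb
    have : (q * (1 + s ^ 2)) • a = 0 := by
      rw [← sub_eq_zero] at hb
      rw [← neg_eq_zero, ← hb]
      module
    rcases smul_eq_zero.1 this with h | h
    · rcases mul_eq_zero.1 h with h | h
      · exact h
      · nlinarith [sq_nonneg s]
    · exact absurd h ha0

lemma eig_unique (hinner : ∀ a c b d : V, ⟪tmul a b, tmul c d⟫ = ⟪a, c⟫ * ⟪b, d⟫)
    (hC : ∀ a b, C (tmul a b) = tmul (T a) (T b))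
    (H : ∀ z w, C z = z → C w = w → z ≠ 0 → ∃ c : ℝ, w = c • z) {e d : ℝ} {u w : V}
    (hu : T u = e • u) (hw : T w = d • w) (he : e ^ 2 = 1) (hd : d ^ 2 = 1) (hu0 : u ≠ 0) :
    ∃ c : ℝ, w = c • u := by
  have key : ∀ (f : ℝ) (x : V), T x = f • x → f ^ 2 = 1 → C (tmul x x) = tmul x x := by
    intro f x hx hf
    rw [hC, hx]
    simp only [map_smul, LinearMap.smul_apply, smul_smul]
    rw [← sq, hf, one_smul]
  by_cases hw0 : w = 0
  · exact ⟨0, by simp [hw0]⟩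
  have hn : ⟪w, w⟫ ≠ 0 := fun h => hw0 (inner_self_eq_zero.1 h)
  have hz : tmul u u ≠ 0 := by
    intro h
    have := hinner u u u u
    rw [h, inner_zero_left] at this
    exact hu0 (inner_self_eq_zero.1 (mul_self_eq_zero.1 this.symm))
  obtain ⟨c, hc⟩ := H _ _ (key e u hu he) (key d w hw hd) hz
  refine ⟨⟪w, w⟫⁻¹ * (c * ⟪u, w⟫), ?_⟩
  rw [mul_smul, eq_inv_smul_iff₀ hn]
  apply ext_inner_right ℝ
  intro x
  have h1 := congrArg (fun z => ⟪z, tmul w x⟫) hc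
  simp only [hinner, real_inner_smul_left] at h1
  simp only [real_inner_smul_left]
  linarith

lemma no_jordan (hinner : ∀ a c b d : V, ⟪tmul a b, tmul c d⟫ = ⟪a, c⟫ * ⟪b, d⟫)
    (hC : ∀ a b, C (tmul a b) = tmul (T a) (T b))
    (H : ∀ z w, C z = z → C w = w → z ≠ 0 → ∃ c : ℝ, w = c • z) {e : ℝ} {u w : V}
    (hu : T u = e • u) (hw : T w = e • w + u) (he : e ^ 2 = 1) : u = 0 := by
  by_contra hu0
  have h1 : C (tmul u u + tmul 0 0) = tmul u u + tmul 0 0 := by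
    simp only [map_zero, add_zero, hC, hu, map_smul, LinearMap.smul_apply, smul_smul]
    rw [← sq, he, one_smul]
  have h2 : C (tmul u w - tmul w u) = tmul u w - tmul w u := by
    have : tmul u w - tmul w u = (e ^ 2) • (tmul u w - tmul w u) := by rw [he, one_smul]
    conv_rhs => rw [this]
    simp only [map_add, map_smul, hC, hu, hw, map_sub, LinearMap.add_apply,
      LinearMap.smul_apply]
    module
  have h3 := antisymm_zero hinner H h1 h2 (Or.inl hu0)
  have d1 := tmul_comm_dep hinner h3
  have hn : ⟪u, u⟫ ≠ 0 := fun h => hu0 (inner_self_eq_zero.1 h)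
  have hws : w = (⟪u, u⟫⁻¹ * ⟪w, u⟫) • u := by
    rw [mul_smul, ← d1, smul_smul, inv_mul_cancel₀ hn, one_smul]
  have : T w = e • w := by
    rw [hws, map_smul, hu, smul_comm]
  rw [this] at hw
  exact hu0 (by simpa using hw)

/-- Structure of the powers. -/
lemma powers [Nontrivial V] (hinner : ∀ a c b d : V, ⟪tmul a b, tmul c d⟫ = ⟪a, c⟫ * ⟪b, d⟫)
    (hC : ∀ a b, C (tmul a b) = tmul (T a) (T b))
    (H : ∀ z w, C z = z → C w = w → z ≠ 0 → ∃ c : ℝ, w = c • z)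
    (hex : ∃ p q a b, EigPair T p q a b ∧ p ^ 2 + q ^ 2 = 1)
    (hle : ∀ p q a b, EigPair T p q a b → p ^ 2 + q ^ 2 ≤ 1) :
    ∃ (e : ℝ) (u y : V), e ^ 2 = 1 ∧ ⟪y, u⟫ = 1 ∧
      ∀ x, Tendsto (fun n : ℕ => (T ^ n) x - e ^ n • ⟪y, x⟫ • u) atTop (𝓝 0) := by
  obtain ⟨e, q, a, b, hab, hpq⟩ := hex
  have hq := pair_real hinner hC H hab hpq
  subst hq
  have he : e ^ 2 = 1 := by simpa using hpq
  obtain ⟨u, hu0, hu⟩ : ∃ u, u ≠ 0 ∧ T u = e • u := by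
    obtain ⟨h0, ha, hb⟩ := hab
    rcases h0 with h | h
    · exact ⟨a, h, by simpa using ha⟩
    · exact ⟨b, h, by simpa using hb⟩
  let R : Submodule ℝ V := LinearMap.range ((T : V →ₗ[ℝ] V) - e • LinearMap.id)
  have huR : u ∉ R := by
    rintro ⟨w, hw⟩
    apply hu0
    apply no_jordan hinner hC H hu (w := w) _ he
    rw [← hw]
    simp
  obtain ⟨y', hy', hyu'⟩ : ∃ y ∈ Rᗮ, ⟪y, u⟫ ≠ 0 := by
    by_contra! hc
    apply huR
    rw [← Submodule.orthogonal_orthogonal R, Submodule.mem_orthogonal]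
    exact hc
  obtain ⟨y, hy, hyu⟩ : ∃ y ∈ Rᗮ, ⟪y, u⟫ = 1 :=
    ⟨⟪y', u⟫⁻¹ • y', Submodule.smul_mem _ _ hy', by
      rw [real_inner_smul_left, inv_mul_cancel₀ hyu']⟩
  have hyT : ∀ x, ⟪y, T x⟫ = e * ⟪y, x⟫ := by
    intro x
    have := (Submodule.mem_orthogonal' R y).1 hy (T x - e • x) ⟨x, by simp⟩
    rw [inner_sub_right, real_inner_smul_right] at this
    linarith
  refine ⟨e, u, y, he, hyu, ?_⟩
  let S : V →L[ℝ] V := T - e • (innerSL ℝ y).smulRight u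
  have hS : ∀ x, S x = T x - e • ⟪y, x⟫ • u := fun x => by simp [S]
  have hyS : ∀ x, ⟪y, S x⟫ = 0 := by
    intro x
    rw [hS, inner_sub_right, hyT, real_inner_smul_right, real_inner_smul_right, hyu]
    ring
  have hSlt : ∀ p q a b, EigPair S p q a b → p ^ 2 + q ^ 2 < 1 := by
    rintro p q a b ⟨h0, ha, hb⟩
    by_contra! hc
    have e1 := hyS a
    have e2 := hyS b
    rw [ha, inner_sub_right, real_inner_smul_right, real_inner_smul_right] at e1
    rw [hb, inner_add_right, real_inner_smul_right, real_inner_smul_right] at e2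
    have ya : ⟪y, a⟫ = 0 := by
      have : (p ^ 2 + q ^ 2) * ⟪y, a⟫ = 0 := by linear_combination p * e1 + q * e2
      rcases mul_eq_zero.1 this with h | h
      · linarith
      · exact h
    have yb : ⟪y, b⟫ = 0 := by
      have : (p ^ 2 + q ^ 2) * ⟪y, b⟫ = 0 := by linear_combination p * e2 - q * e1
      rcases mul_eq_zero.1 this with h | h
      · linarith
      · exact h
    have hT : EigPair T p q a b := by
      refine ⟨h0, ?_, ?_⟩
      · rw [← ha, hS, ya]; simp
      · rw [← hb, hS, yb]; simp
    have hpq' : p ^ 2 + q ^ 2 = 1 := le_antisymm (hle _ _ _ _ hT) hc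
    have hq := pair_real hinner hC H hT hpq'
    subst hq
    have hp : p ^ 2 = 1 := by simpa using hpq'
    obtain ⟨_, ta, tb⟩ := hT
    have zer : ∀ x, T x = p • x → ⟪y, x⟫ = 0 → x = 0 := by
      intro x hx hyx
      obtain ⟨c, hc⟩ := eig_unique hinner hC H hu hx he hp hu0
      rw [hc, real_inner_smul_right, hyu, mul_one] at hyx
      rw [hc, hyx, zero_smul]
    have := zer a (by simpa using ta) ya
    have := zer b (by simpa using tb) yb
    tauto
  have hlim := pow_tendsto S hSlt
  intro x
  have hform : ∀ n : ℕ, (T ^ n) x - e ^ n • ⟪y, x⟫ • u = (S ^ n) (x - ⟪y, x⟫ • u) ∧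
      ⟪y, (S ^ n) (x - ⟪y, x⟫ • u)⟫ = 0 := by
    intro n
    induction n with
    | zero =>
      simp [inner_sub_right, real_inner_smul_right, hyu]
    | succ k ih =>
      rw [pow_succ' S, mul_apply_eq_comp]
      refine ⟨?_, hyS _⟩
      rw [hS, ih.2, ← ih.1, pow_succ' T, mul_apply_eq_comp, map_sub, map_smul,
        map_smul, hu]
      module
  have := ((ContinuousLinearMap.apply ℝ V (x - ⟪y, x⟫ • u)).continuous.tendsto 0).comp hlim
  rw [map_zero] at this
  exact this.congr fun n => (hform n).1.symm

end Algebraic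

section Scale

set_option linter.unusedSectionVars false

lemma tmul_scale {tmul : V →ₗ[ℝ] V →ₗ[ℝ] W} {A : V →L[ℝ] V} {B : W →L[ℝ] W} {r : ℝ}
    (hB : ∀ a b : V, B (tmul a b) = tmul (A a) (A b)) (a b : V) :
    ((r ^ 2)⁻¹ • (B : W →ₗ[ℝ] W)) (tmul a b) = tmul ((r⁻¹ • A) a) ((r⁻¹ • A) b) := by
  simp only [LinearMap.smul_apply, ContinuousLinearMap.coe_coe, hB,
    ContinuousLinearMap.smul_apply, map_smul, smul_smul]
  congr 1
  rw [sq, mul_inv]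

lemma scale_fix {B : W →L[ℝ] W} {r : ℝ} (hr : r ≠ 0) (z : W) :
    ((r ^ 2)⁻¹ • (B : W →ₗ[ℝ] W)) z = z ↔ B z = r ^ 2 • z := by
  simp only [LinearMap.smul_apply, ContinuousLinearMap.coe_coe]
  exact inv_smul_eq_iff₀ (pow_ne_zero 2 hr)

lemma tmul_tendsto (tmul : V →ₗ[ℝ] V →ₗ[ℝ] W) {f g : ℕ → V} {x y : V}
    (hf : Tendsto f atTop (𝓝 x)) (hg : Tendsto g atTop (𝓝 y)) :
    Tendsto (fun n => tmul (f n) (g n)) atTop (𝓝 (tmul x y)) := by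
  have hc : Continuous fun p : V × V => LinearMap.toContinuousBilinearMap tmul p.1 p.2 := by
    fun_prop
  exact (hc.tendsto (x, y)).comp (hf.prodMk_nhds hg)

end Scale

theorem stmt_8 (K : Set V) (hKcl : IsClosed K) (hKconv : Convex ℝ K)
    (hKcone : ∀ c : ℝ, 0 ≤ c → ∀ x ∈ K, c • x ∈ K)
    (hKint : (interior K).Nonempty) (hKpt : K ∩ (-K) = {(0 : V)})
    (tmul : V →ₗ[ℝ] V →ₗ[ℝ] W)
    (hinner : ∀ a c b d : V, ⟪tmul a b, tmul c d⟫ = ⟪a, c⟫ * ⟪b, d⟫)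
    (hspan : Submodule.span ℝ {z : W | ∃ a b, z = tmul a b} = ⊤)
    (A : V →L[ℝ] V) (hA : ∀ x ∈ K, A x ∈ K)
    (B : W →L[ℝ] W) (hB : ∀ a b : V, B (tmul a b) = tmul (A a) (A b)) :
    IsMixing K A ↔
      (0 < specRad A ∧
        Module.finrank ℝ
          (Module.End.eigenspace (B : W →ₗ[ℝ] W) ((specRad A) ^ 2)) = 1) := by
  constructor
  · rintro ⟨x₀, y₀, hr, hx₀, hy₀, hxy, hlim⟩
    refine ⟨hr, ?_⟩
    set r := specRad A with hrdef
    let T : V →L[ℝ] V := r⁻¹ • A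
    let C : W →ₗ[ℝ] W := (r ^ 2)⁻¹ • (B : W →ₗ[ℝ] W)
    have hC : ∀ a b, C (tmul a b) = tmul (T a) (T b) := tmul_scale hB
    have hCfix : ∀ z, C z = z ↔ B z = r ^ 2 • z := scale_fix hr.ne'
    have hlim' : ∀ x : V, Tendsto (fun n : ℕ => (T ^ n) x) atTop (𝓝 (⟪y₀, x⟫ • x₀)) := hlim
    have hTx : T x₀ = x₀ := by
      have h1 := hlim' x₀
      rw [hxy, one_smul] at h1
      have h2 := (T.continuous.tendsto x₀).comp h1
      have h3 := h1.comp (tendsto_add_atTop_nat 1)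
      refine tendsto_nhds_unique h2 (h3.congr fun n => ?_)
      simp only [Function.comp, pow_succ', mul_apply_eq_comp]
    have hx0 : x₀ ≠ 0 := by
      rintro rfl
      simp at hxy
    have hz0 : tmul x₀ x₀ ≠ 0 := by
      intro h
      have := hinner x₀ x₀ x₀ x₀
      rw [h, inner_zero_left] at this
      exact hx0 (inner_self_eq_zero.1 (mul_self_eq_zero.1 this.symm))
    have hCn : ∀ (n : ℕ) a b, (C ^ n) (tmul a b) = tmul ((T ^ n) a) ((T ^ n) b) := by
      intro n a b
      induction n with
      | zero => simp
      | succ k ih =>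
        rw [pow_succ', pow_succ', Module.End.mul_apply, mul_apply_eq_comp, mul_apply_eq_comp, ih, hC]
    have hconv : ∀ z : W, ∃ c : ℝ, Tendsto (fun n : ℕ => (C ^ n) z) atTop (𝓝 (c • tmul x₀ x₀)) := by
      intro z
      have hz : z ∈ Submodule.span ℝ {z : W | ∃ a b, z = tmul a b} := by rw [hspan]; trivial
      induction hz using Submodule.span_induction with
      | mem z hz =>
        obtain ⟨a, b, rfl⟩ := hz
        refine ⟨⟪y₀, a⟫ * ⟪y₀, b⟫, ?_⟩
        have h := tmul_tendsto tmul (hlim' a) (hlim' b)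
        simp only [map_smul, LinearMap.smul_apply, smul_smul] at h
        rw [mul_comm] at h
        exact h.congr fun n => (hCn n a b).symm
      | zero => exact ⟨0, by simp⟩
      | add z w _ _ hz hw =>
        obtain ⟨c, hc⟩ := hz
        obtain ⟨d, hd⟩ := hw
        refine ⟨c + d, ?_⟩
        rw [add_smul]
        simpa using hc.add hd
      | smul t z _ hz =>
        obtain ⟨c, hc⟩ := hz
        refine ⟨t * c, ?_⟩
        rw [mul_smul]
        simpa using hc.const_smul t
    have hmem : tmul x₀ x₀ ∈ Module.End.eigenspace (B : W →ₗ[ℝ] W) (r ^ 2) := by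
      rw [Module.End.mem_eigenspace_iff]
      exact (hCfix _).1 (by rw [hC, hTx])
    rw [finrank_eq_one_iff_of_nonzero' (⟨tmul x₀ x₀, hmem⟩ :
      Module.End.eigenspace (B : W →ₗ[ℝ] W) (r ^ 2)) (by simpa [Subtype.ext_iff] using hz0)]
    rintro ⟨z, hz⟩
    rw [Module.End.mem_eigenspace_iff] at hz
    have hz' : C z = z := (hCfix z).2 hz
    obtain ⟨c, hc⟩ := hconv z
    refine ⟨c, ?_⟩
    apply Subtype.ext
    have hconst : ∀ n : ℕ, (C ^ n) z = z := by
      intro n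
      induction n with
      | zero => simp
      | succ k ih => rw [pow_succ', Module.End.mul_apply, ih, hz']
    simp only [hconst] at hc
    exact (tendsto_nhds_unique tendsto_const_nhds hc).symm
  · rintro ⟨hr, hfin⟩
    set r := specRad A with hrdef
    let T : V →L[ℝ] V := r⁻¹ • A
    let C : W →ₗ[ℝ] W := (r ^ 2)⁻¹ • (B : W →ₗ[ℝ] W)
    have hC : ∀ a b, C (tmul a b) = tmul (T a) (T b) := tmul_scale hB
    have hCfix : ∀ z, C z = z ↔ B z = r ^ 2 • z := scale_fix hr.ne'
    have hr0 := hr.ne'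
    have hmem : ∀ z, C z = z → z ∈ Module.End.eigenspace (B : W →ₗ[ℝ] W) (r ^ 2) := by
      intro z hz
      rw [Module.End.mem_eigenspace_iff]
      exact (hCfix z).1 hz
    have H : ∀ z w, C z = z → C w = w → z ≠ 0 → ∃ c : ℝ, w = c • z := by
      intro z w hz hw hz0
      obtain ⟨c, hc⟩ := (finrank_eq_one_iff_of_nonzero' (⟨z, hmem z hz⟩ :
        Module.End.eigenspace (B : W →ₗ[ℝ] W) (r ^ 2))
        (by simpa [Subtype.ext_iff] using hz0)).1 hfin ⟨w, hmem w hw⟩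
      exact ⟨c, (congrArg Subtype.val hc).symm⟩
    have hnt : Nontrivial V := by
      by_contra hn
      rw [not_nontrivial_iff_subsingleton] at hn
      have : specRad A = 0 := by
        apply Tendsto.limsup_eq
        refine tendsto_const_nhds.congr' ?_
        filter_upwards [eventually_gt_atTop 0] with n hn0
        have h0 : A ^ n = 0 := Subsingleton.elim _ _
        rw [h0, norm_zero, Real.zero_rpow]
        positivity
      exact hr0 this
    have hex : ∃ p q a b, EigPair T p q a b ∧ p ^ 2 + q ^ 2 = 1 := by
      obtain ⟨p, q, a, b, ⟨h0, ha, hb⟩, hpq⟩ := spec_exists A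
      refine ⟨r⁻¹ * p, r⁻¹ * q, a, b, ⟨h0, ?_, ?_⟩, ?_⟩
      · simp only [T, ContinuousLinearMap.smul_apply, ha]; module
      · simp only [T, ContinuousLinearMap.smul_apply, hb]; module
      · rw [← hrdef] at hpq
        field_simp
        exact hpq
    have hle : ∀ p q a b, EigPair T p q a b → p ^ 2 + q ^ 2 ≤ 1 := by
      rintro p q a b ⟨h0, ha, hb⟩
      have hAT : ∀ x, A x = r • T x := by
        intro x
        simp only [T, ContinuousLinearMap.smul_apply, smul_smul]
        rw [mul_inv_cancel₀ hr0, one_smul]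
      have hp : EigPair A (r * p) (r * q) a b := by
        refine ⟨h0, ?_, ?_⟩
        · rw [hAT, ha]; module
        · rw [hAT, hb]; module
      have h := spec_le A hp
      rw [← hrdef] at h
      have hr2 : 0 < r ^ 2 := by positivity
      by_contra! hc
      nlinarith
    obtain ⟨e, u, y, he, hyu, hlim⟩ := powers hinner hC H hex hle
    have hTK : ∀ x ∈ K, ∀ n : ℕ, (T ^ n) x ∈ K := by
      intro x hx n
      induction n with
      | zero => simpa using hx
      | succ k ih =>
        rw [pow_succ', mul_apply_eq_comp]
        exact hKcone _ (by positivity) _ (hA _ ih)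
    have hzero : ∀ x, x ∈ K → -x ∈ K → x = 0 := by
      intro x h1 h2
      have : x ∈ K ∩ (-K) := ⟨h1, h2⟩
      rw [hKpt] at this
      exact this
    have hu0 : u ≠ 0 := by
      rintro rfl
      simp at hyu
    -- a point of the cone not orthogonal to y
    obtain ⟨x₁, hx₁, hyx₁⟩ : ∃ x ∈ K, ⟪y, x⟫ ≠ 0 := by
      by_contra! hc
      obtain ⟨k, hk⟩ := hKint
      have hev : ∀ᶠ t : ℝ in 𝓝 0, k + t • u ∈ K := by
        have hcont : Tendsto (fun t : ℝ => k + t • u) (𝓝 0) (𝓝 k) := by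
          have : Continuous (fun t : ℝ => k + t • u) := by fun_prop
          simpa using this.tendsto 0
        exact hcont.eventually (mem_interior_iff_mem_nhds.1 hk)
      have hev2 : ∀ᶠ t : ℝ in 𝓝[≠] 0, k + t • u ∈ K := hev.filter_mono nhdsWithin_le_nhds
      obtain ⟨t, ht, ht0⟩ := (hev2.and self_mem_nhdsWithin).exists
      have h1 := hc _ ht
      rw [inner_add_right, hc _ (interior_subset hk), real_inner_smul_right, hyu] at h1
      apply ht0
      simpa using h1
    -- even powers
    have heven : ∀ x ∈ K, ⟪y, x⟫ • u ∈ K := by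
      intro x hx
      have h1 := (hlim x).comp (tendsto_atTop_mono (fun n : ℕ => (by omega : n ≤ 2 * n)) tendsto_id)
      have h2 := h1.add_const (⟪y, x⟫ • u)
      rw [zero_add] at h2
      refine hKcl.mem_of_tendsto h2 (Eventually.of_forall fun n => ?_)
      simp only [Function.comp, id, pow_mul, he, one_pow, one_smul, sub_add_cancel]
      rw [← pow_mul]
      exact hTK x hx _
    have he1 : e = 1 := by
      rcases (by simpa using he : e = 1 ∨ e = -1) with h | h
      · exact h
      · exfalso
        have h1 := (hlim x₁).comp (tendsto_atTop_mono (fun n : ℕ => (by omega : n ≤ 2 * n + 1)) tendsto_id)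
        have h2 := h1.add_const (-(⟪y, x₁⟫ • u))
        rw [zero_add] at h2
        refine smul_ne_zero hyx₁ hu0 (hzero _ (heven _ hx₁)
          (hKcl.mem_of_tendsto h2 (Eventually.of_forall fun n => ?_)))
        have h3 : e ^ (2 * n + 1) = -1 := by rw [pow_succ, pow_mul, he, h]; simp
        simp only [Function.comp, h3]
        have h4 := hTK x₁ hx₁ (2 * n + 1)
        simpa using h4
    subst he1
    have hlim2 : ∀ x : V, Tendsto (fun n : ℕ => (T ^ n) x) atTop (𝓝 (⟪y, x⟫ • u)) := by
      intro x
      have := (hlim x).add_const (⟪y, x⟫ • u)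
      simpa using this
    refine ⟨⟪y, x₁⟫ • u, ⟪y, x₁⟫⁻¹ • y, hr, heven _ hx₁, ?_, ?_, ?_⟩
    · intro x hx
      by_contra! hneg
      have h1 := heven _ hx
      have h2 := heven _ hx₁
      apply smul_ne_zero hyx₁ hu0
      apply hzero _ h2
      have h3 := hKcone (-(⟪⟪y, x₁⟫⁻¹ • y, x⟫))⁻¹ (by rw [inv_nonneg]; linarith) _ h1
      rw [real_inner_smul_left] at h3 hneg
      have hyx : ⟪y, x⟫ ≠ 0 := by
        intro h
        rw [h] at hneg
        simp at hneg
      convert h3 using 1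
      rw [smul_smul, ← neg_smul]
      congr 1
      field_simp
    · rw [real_inner_smul_left, real_inner_smul_right, hyu, mul_one, inv_mul_cancel₀ hyx₁]
    · intro x
      have h := hlim2 x
      have e1 : ⟪⟪y, x₁⟫⁻¹ • y, x⟫ • ⟪y, x₁⟫ • u = ⟪y, x⟫ • u := by
        rw [real_inner_smul_left, smul_smul]
        congr 1
        field_simp
      rw [e1]
      exact h
end

section
/- Let K̃ be a closed convex cone with K⊗K ⊆ K̃ ⊆ ((K*)⊗(K*))*, A a K-positive map, and suppose A⊗A is K̃-positive. Then A is K-mixing if and only if A⊗A is K̃-ergodic. -/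
open Filter Topology RealInnerProductSpace

variable {V : Type*} [NormedAddCommGroup V] [InnerProductSpace ℝ V] [FiniteDimensional ℝ V]

variable {W : Type*} [NormedAddCommGroup W] [InnerProductSpace ℝ W] [FiniteDimensional ℝ W]

set_option linter.unusedSectionVars false

lemma h10_specRad_eq (A : V →L[ℝ] V) (r : ℝ) (hr : 0 < r) (L : V → V)
    (h : ∀ x, Tendsto (fun n : ℕ => ((r⁻¹ • A) ^ n) x) atTop (𝓝 (L x)))
    (x : V) (hx : L x ≠ 0) :
    specRad A = r := by
  have : CompleteSpace V := FiniteDimensional.complete ℝ V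
  obtain ⟨C, hC⟩ : ∃ C, ∀ n : ℕ, ‖(r⁻¹ • A) ^ n‖ ≤ C := by
    apply banach_steinhaus
    intro x
    obtain ⟨C, hC⟩ := (h x).norm.bddAbove_range
    exact ⟨C, fun n => hC ⟨n, rfl⟩⟩
  have hx0 : x ≠ 0 := by
    rintro rfl
    apply hx
    have h0 := h 0
    simp only [map_zero] at h0
    exact tendsto_nhds_unique h0 tendsto_const_nhds
  have hxn : 0 < ‖x‖ := norm_pos_iff.mpr hx0
  have hLn : 0 < ‖L x‖ := norm_pos_iff.mpr hx
  set c := ‖L x‖ / 2 / ‖x‖ with hc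
  have hcpos : 0 < c := by positivity
  have hlow : ∀ᶠ n : ℕ in atTop, c ≤ ‖(r⁻¹ • A) ^ n‖ := by
    have := (h x).norm.eventually (lt_mem_nhds (show ‖L x‖ / 2 < ‖L x‖ by linarith))
    filter_upwards [this] with n hn
    rw [hc, div_le_iff₀ hxn]
    exact hn.le.trans (ContinuousLinearMap.le_opNorm _ _)
  have hCpos : 0 < C := by
    obtain ⟨n, hn⟩ := hlow.exists
    exact hcpos.trans_le (hn.trans (hC n))
  have hroot : ∀ d : ℝ, 0 < d → Tendsto (fun n : ℕ => r * d ^ ((n : ℝ)⁻¹)) atTop (𝓝 r) := by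
    intro d hd
    have h1 : Tendsto (fun n : ℕ => ((n : ℝ)⁻¹)) atTop (𝓝 0) := tendsto_inv_atTop_nhds_zero_nat
    have h2 := (Real.continuousAt_const_rpow hd.ne' (b := 0)).tendsto.comp h1
    have h3 := h2.const_mul r
    simpa using h3
  have heq : ∀ n : ℕ, n ≠ 0 → ‖A ^ n‖ ^ ((n : ℝ)⁻¹) = r * ‖(r⁻¹ • A) ^ n‖ ^ ((n : ℝ)⁻¹) := by
    intro n hn
    have : A ^ n = r ^ n • (r⁻¹ • A) ^ n := by
      rw [smul_pow, smul_smul, ← mul_pow, mul_inv_cancel₀ hr.ne', one_pow, one_smul]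
    conv_lhs => rw [this, norm_smul, norm_pow, Real.norm_of_nonneg hr.le,
      Real.mul_rpow (by positivity) (by positivity), Real.pow_rpow_inv_natCast hr.le hn]
  apply Tendsto.limsup_eq
  refine tendsto_of_tendsto_of_tendsto_of_le_of_le' (hroot c hcpos) (hroot C hCpos) ?_ ?_
  · filter_upwards [hlow, eventually_ne_atTop 0] with n hn hn0
    rw [heq n hn0]
    gcongr
  · filter_upwards [eventually_ne_atTop 0] with n hn0
    rw [heq n hn0]
    gcongr
    exact hC n

/-- The dual cone of a pointed closed convex cone spans. -/
lemma h10_dual_span (K : Set V) (hKcl : IsClosed K) (hKconv : Convex ℝ K)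
    (hKcone : ∀ c : ℝ, 0 ≤ c → ∀ x ∈ K, c • x ∈ K)
    (hKpt : K ∩ (-K) = {(0 : V)}) : Submodule.span ℝ (dualSet K) = ⊤ := by
  have h0 : (0 : V) ∈ K := by
    have : (0 : V) ∈ K ∩ (-K) := by rw [hKpt]; rfl
    exact this.1
  have key : ∀ w : V, (∀ y ∈ dualSet K, ⟪y, w⟫ = 0) → w ∈ K := by
    intro w hw
    by_contra hwK
    obtain ⟨f, u, hfu, hf⟩ := geometric_hahn_banach_point_closed hKconv hKcl hwK
    have hu : u < 0 := by simpa using hf 0 h0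
    set y := (InnerProductSpace.toDual ℝ V).symm f with hy
    have hyf : ∀ x, ⟪y, x⟫ = f x := fun x => by
      rw [hy, InnerProductSpace.toDual_symm_apply]
    have hyd : y ∈ dualSet K := by
      intro x hx
      rw [hyf]
      by_contra hneg
      push Not at hneg
      have := hf _ (hKcone (u / f x) (div_nonneg_of_nonpos hu.le hneg.le) x hx)
      rw [map_smul, smul_eq_mul, div_mul_cancel₀ _ hneg.ne] at this
      exact lt_irrefl _ this
    have := hw y hyd
    rw [hyf] at this
    linarith
  rw [← Submodule.orthogonal_eq_bot_iff, Submodule.eq_bot_iff]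
  intro w hw
  have hw' : ∀ y ∈ dualSet K, ⟪y, w⟫ = 0 := fun y hy =>
    (Submodule.mem_orthogonal _ _).mp hw y (Submodule.subset_span hy)
  have : w ∈ K ∩ (-K) := ⟨key w hw', key (-w) fun y hy => by rw [inner_neg_right, hw' y hy, neg_zero]⟩
  rw [hKpt] at this
  exact this

lemma h10_span (K : Set V) (hKint : (interior K).Nonempty) : Submodule.span ℝ K = ⊤ :=
  Submodule.eq_top_of_nonempty_interior' _ (hKint.mono (interior_mono Submodule.subset_span))

section
variable {T : V →L[ℝ] V} {S : W →L[ℝ] W} {tmul : V →ₗ[ℝ] V →ₗ[ℝ] W}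

lemma h10_pow (hST : ∀ a b, S (tmul a b) = tmul (T a) (T b)) (n : ℕ) (a b : V) :
    (S ^ n) (tmul a b) = tmul ((T ^ n) a) ((T ^ n) b) := by
  induction n generalizing a b with
  | zero => simp
  | succ n ih => simp [pow_succ, hST, ih]

lemma h10_tmul_tendsto {u v : ℕ → V} {a b : V} (hu : Tendsto u atTop (𝓝 a))
    (hv : Tendsto v atTop (𝓝 b)) :
    Tendsto (fun n => tmul (u n) (v n)) atTop (𝓝 (tmul a b)) := by
  let f : V →ₗ[ℝ] (V →L[ℝ] W) := (LinearMap.toContinuousLinearMap : (V →ₗ[ℝ] W) ≃ₗ[ℝ] _).toLinearMap.comp tmul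
  have hf : Continuous f := f.continuous_of_finiteDimensional
  exact ((isBoundedBilinearMap_apply (𝕜 := ℝ) (E := V) (F := W)).continuous.tendsto
    (f a, b)).comp (((hf.tendsto a).comp hu).prodMk_nhds hv)

/-- power boundedness from Cesàro bounds on squares -/
lemma h10_powbdd (h : ∀ a : V, ∃ q : ℝ, Tendsto
      (fun n : ℕ => (n : ℝ)⁻¹ * ∑ k ∈ Finset.range n, ‖(T ^ k) a‖ ^ 2) atTop (𝓝 q)) :
    ∃ M : ℝ, 0 < M ∧ ∀ n : ℕ, ‖T ^ n‖ ≤ M := by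
  let e := stdOrthonormalBasis ℝ V
  have h1 : ∀ i, ∃ C : ℝ, ∀ n : ℕ, ∑ k ∈ Finset.range n, ‖(T ^ k) (e i)‖ ^ 2 ≤ C * n := by
    intro i
    obtain ⟨q, hq⟩ := h (e i)
    obtain ⟨C, hC⟩ := hq.bddAbove_range
    refine ⟨C, fun n => ?_⟩
    have := hC ⟨n, rfl⟩
    rcases Nat.eq_zero_or_pos n with rfl | hn
    · simp
    · have hn' : (0 : ℝ) < n := by exact_mod_cast hn
      simp only at this
      rwa [inv_mul_le_iff₀ hn', mul_comm] at this
  choose C hC using h1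
  set d : ℝ := ((Module.finrank ℝ V : ℕ) : ℝ) with hd
  have hop : ∀ k : ℕ, ‖T ^ k‖ ^ 2 ≤ d * ∑ i, ‖(T ^ k) (e i)‖ ^ 2 := by
    intro k
    have h2 : ‖T ^ k‖ ≤ ∑ i, ‖(T ^ k) (e i)‖ := by
      refine ContinuousLinearMap.opNorm_le_bound _ (by positivity) fun x => ?_
      conv_lhs => rw [← e.sum_repr' x, map_sum]
      refine (norm_sum_le _ _).trans ?_
      rw [Finset.sum_mul]
      refine Finset.sum_le_sum fun i _ => ?_
      rw [map_smul, norm_smul, mul_comm]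
      gcongr
      simpa using norm_inner_le_norm (𝕜 := ℝ) (e i) x
    calc ‖T ^ k‖ ^ 2 ≤ (∑ i, ‖(T ^ k) (e i)‖) ^ 2 := by gcongr
      _ ≤ _ := by
        have := sq_sum_le_card_mul_sum_sq (s := Finset.univ) (f := fun i => ‖(T ^ k) (e i)‖)
        simpa [hd] using this
  set D := d * ∑ i, C i with hD
  have hsum : ∀ n : ℕ, ∑ k ∈ Finset.range n, ‖T ^ k‖ ^ 2 ≤ D * n := by
    intro n
    calc ∑ k ∈ Finset.range n, ‖T ^ k‖ ^ 2
        ≤ ∑ k ∈ Finset.range n, d * ∑ i, ‖(T ^ k) (e i)‖ ^ 2 := Finset.sum_le_sum fun k _ => hop k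
      _ = d * ∑ i, ∑ k ∈ Finset.range n, ‖(T ^ k) (e i)‖ ^ 2 := by
        rw [← Finset.mul_sum, Finset.sum_comm]
      _ ≤ d * ∑ i, C i * n := by
        gcongr with i _
        exact hC i n
      _ = D * n := by rw [← Finset.sum_mul, hD]; ring
  refine ⟨max D 1, by positivity, fun n => le_trans ?_ (le_max_left _ _)⟩
  have h3 : ((n + 1 : ℕ) : ℝ) * ‖T ^ n‖ ≤ D * ((n + 1 : ℕ) : ℝ) := by
    calc ((n + 1 : ℕ) : ℝ) * ‖T ^ n‖ = ∑ k ∈ Finset.range (n + 1), ‖T ^ n‖ := by simp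
      _ ≤ ∑ k ∈ Finset.range (n + 1), (‖T ^ k‖ ^ 2 + ‖T ^ (n - k)‖ ^ 2) / 2 := by
        refine Finset.sum_le_sum fun k hk => ?_
        have hk' : k + (n - k) = n := by
          have := Finset.mem_range.mp hk
          omega
        have h4 : ‖T ^ n‖ ≤ ‖T ^ k‖ * ‖T ^ (n - k)‖ := by
          conv_lhs => rw [← hk', pow_add]
          exact norm_mul_le _ _
        nlinarith [sq_nonneg (‖T ^ k‖ - ‖T ^ (n - k)‖)]
      _ = ∑ k ∈ Finset.range (n + 1), ‖T ^ k‖ ^ 2 := by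
        rw [← Finset.sum_div, Finset.sum_add_distrib,
          Finset.sum_flip (fun k => ‖T ^ k‖ ^ 2)]
        ring
      _ ≤ _ := hsum _
  have hn : (0 : ℝ) < ((n + 1 : ℕ) : ℝ) := by positivity
  nlinarith
end

lemma h10_main (K : Set V) (hKcl : IsClosed K) (hKconv : Convex ℝ K)
    (hKcone : ∀ c : ℝ, 0 ≤ c → ∀ x ∈ K, c • x ∈ K)
    (hKint : (interior K).Nonempty) (hKpt : K ∩ (-K) = {(0 : V)})
    (tmul : V →ₗ[ℝ] V →ₗ[ℝ] W)
    (hinner : ∀ a c b d : V, ⟪tmul a b, tmul c d⟫ = ⟪a, c⟫ * ⟪b, d⟫)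
    (hspan : Submodule.span ℝ {z : W | ∃ a b, z = tmul a b} = ⊤)
    (T : V →L[ℝ] V) (hT : ∀ x ∈ K, T x ∈ K)
    (S : W →L[ℝ] W) (hST : ∀ a b : V, S (tmul a b) = tmul (T a) (T b))
    (xt yt : W) (hyt : ∀ a ∈ K, ∀ b ∈ K, 0 ≤ ⟪yt, tmul a b⟫) (hxy : ⟪yt, xt⟫ = 1)
    (hces : ∀ z : W, Tendsto
      (fun n : ℕ => (n : ℝ)⁻¹ • ∑ k ∈ Finset.range n, (S ^ k) z) atTop (𝓝 (⟪yt, z⟫ • xt))) :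
    ∃ x₀ ∈ K, ∃ y₀ ∈ dualSet K, ⟪y₀, x₀⟫ = 1 ∧
      ∀ x, Tendsto (fun n : ℕ => (T ^ n) x) atTop (𝓝 (⟪y₀, x⟫ • x₀)) := by
  have hpow := h10_pow hST
  have hTn : ∀ (n : ℕ), ∀ x ∈ K, (T ^ n) x ∈ K := by
    intro n
    induction n with
    | zero => intro x hx; simpa using hx
    | succ n ih => intro x hx; rw [pow_succ]; exact ih _ (hT x hx)
  have hadd : ∀ x ∈ K, ∀ y ∈ K, x + y ∈ K := by
    intro x hx y hy
    have h1 := hKconv hx hy (a := 1 / 2) (b := 1 / 2) (by norm_num) (by norm_num) (by norm_num)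
    have h2 := hKcone 2 (by norm_num) _ h1
    rw [← smul_add, smul_smul] at h2
    norm_num at h2
    exact h2
  have h0K : (0 : V) ∈ K := by
    have : (0 : V) ∈ K ∩ (-K) := by rw [hKpt]; rfl
    exact this.1
  -- scalar Cesàro limits
  have hsc : ∀ w z : W, Tendsto
      (fun n : ℕ => (n : ℝ)⁻¹ * ∑ k ∈ Finset.range n, ⟪w, (S ^ k) z⟫) atTop
      (𝓝 (⟪yt, z⟫ * ⟪w, xt⟫)) := by
    intro w z
    have := (tendsto_const_nhds (x := w)).inner (𝕜 := ℝ) (hces z)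
    simpa only [inner_smul_right, inner_sum] using this
  -- the canonical tensor
  let e := stdOrthonormalBasis ℝ V
  set E : W := ∑ i, tmul (e i) (e i) with hE
  have hEn : ∀ (a : V) (k : ℕ), ⟪E, (S ^ k) (tmul a a)⟫ = ‖(T ^ k) a‖ ^ 2 := by
    intro a k
    rw [hpow, hE, sum_inner, ← e.sum_sq_norm_inner_right]
    refine Finset.sum_congr rfl fun i _ => ?_
    rw [hinner, Real.norm_eq_abs, sq_abs, sq]
  have hsq : ∀ a : V, Tendsto
      (fun n : ℕ => (n : ℝ)⁻¹ * ∑ k ∈ Finset.range n, ‖(T ^ k) a‖ ^ 2) atTop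
      (𝓝 (⟪yt, tmul a a⟫ * ⟪E, xt⟫)) := by
    intro a
    simpa only [hEn] using hsc E (tmul a a)
  obtain ⟨M, hM, hMb⟩ := h10_powbdd (T := T) fun a => ⟨_, hsq a⟩
  have hMv : ∀ (n : ℕ) (v : V), ‖(T ^ n) v‖ ≤ M * ‖v‖ := fun n v =>
    (T ^ n).le_of_opNorm_le (hMb n) v
  have hxt : xt ≠ 0 := by
    rintro rfl
    simp at hxy
  -- Cesàro averages for T
  set c : V → ℕ → V := fun v n => (n : ℝ)⁻¹ • ∑ k ∈ Finset.range n, (T ^ k) v with hc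
  have hcK : ∀ v ∈ K, ∀ n, c v n ∈ K := by
    intro v hv n
    refine hKcone _ (by positivity) _ ?_
    exact Finset.sum_induction _ (· ∈ K) (fun a b ha hb => hadd a ha b hb) h0K
      fun k _ => hTn k v hv
  -- some average does not go to zero
  have hex : ∃ v ∈ K, ¬ Tendsto (c v) atTop (𝓝 0) := by
    by_contra hcon
    push Not at hcon
    have hz : ∀ v ∈ K, ∀ w ∈ K, ∀ y ∈ dualSet K, ∀ y' ∈ dualSet K,
        ⟪yt, tmul v w⟫ * ⟪tmul y y', xt⟫ = 0 := by
      intro v hv w hw y hy y' hy'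
      have h1 := hsc (tmul y y') (tmul v w)
      refine tendsto_nhds_unique h1 ?_
      have h2 : Tendsto (fun n => (‖y'‖ * (M * ‖w‖)) * ⟪y, c v n⟫) atTop (𝓝 0) := by
        have := ((tendsto_const_nhds (x := y)).inner (𝕜 := ℝ) (hcon v hv)).const_mul
          (‖y'‖ * (M * ‖w‖))
        simpa using this
      refine squeeze_zero (fun n => ?_) (fun n => ?_) h2
      · refine mul_nonneg (by positivity) (Finset.sum_nonneg fun k _ => ?_)
        rw [hpow, hinner]
        exact mul_nonneg (hy _ (hTn k v hv)) (hy' _ (hTn k w hw))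
      · rw [hc]
        simp only
        rw [inner_smul_right, inner_sum, mul_left_comm (‖y'‖ * (M * ‖w‖)),
          Finset.mul_sum _ _ (‖y'‖ * (M * ‖w‖))]
        refine mul_le_mul_of_nonneg_left (Finset.sum_le_sum fun k _ => ?_) (by positivity)
        rw [hpow, hinner, mul_comm]
        refine mul_le_mul_of_nonneg_right ?_ (hy _ (hTn k v hv))
        refine (real_inner_le_norm _ _).trans ?_
        exact mul_le_mul_of_nonneg_left (hMv k w) (norm_nonneg _)
    -- spanning
    have hsp2 : ∀ {s : Set V}, Submodule.span ℝ s = ⊤ → ∀ f : V →ₗ[ℝ] V →ₗ[ℝ] ℝ,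
        (∀ a ∈ s, ∀ b ∈ s, f a b = 0) → f = 0 := by
      intro s hs f hf
      refine LinearMap.ext_on hs fun a ha => ?_
      refine LinearMap.ext_on hs fun b hb => ?_
      simpa using hf a ha b hb
    have hspz : ∀ w : W, (∀ a b, ⟪w, tmul a b⟫ = 0) → w = 0 := by
      intro w hw
      have : (innerₛₗ ℝ w : W →ₗ[ℝ] ℝ) = 0 := by
        refine LinearMap.ext_on hspan ?_
        rintro z ⟨a, b, rfl⟩
        simpa using hw a b
      have h3 := LinearMap.congr_fun this w
      simpa using h3
    have hxt0 : ∀ v ∈ K, ∀ w ∈ K, ⟪yt, tmul v w⟫ = 0 := by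
      intro v hv w hw
      by_contra hne
      apply hxt
      apply hspz
      have hf := hsp2 (h10_dual_span K hKcl hKconv hKcone hKpt)
        (tmul.compr₂ (innerₛₗ ℝ xt : W →ₗ[ℝ] ℝ)) (fun y hy y' hy' => by
          have := (mul_eq_zero.mp (hz v hv w hw y hy y' hy')).resolve_left hne
          simpa [real_inner_comm] using this)
      intro a b
      simpa using LinearMap.congr_fun (LinearMap.congr_fun hf a) b
    have hyt0 : yt = 0 := by
      apply hspz
      have hf := hsp2 (h10_span K hKint)
        (tmul.compr₂ (innerₛₗ ℝ yt : W →ₗ[ℝ] ℝ)) (fun y hy y' hy' => by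
          simpa using hxt0 y hy y' hy')
      intro a b
      simpa using LinearMap.congr_fun (LinearMap.congr_fun hf a) b
    rw [hyt0] at hxy
    simp at hxy
  obtain ⟨v, hv, hvn⟩ := hex
  -- a nonzero fixed vector
  obtain ⟨x₁, hx₁K, hx₁0, hx₁T⟩ : ∃ x₁ ∈ K, x₁ ≠ 0 ∧ T x₁ = x₁ := by
    have hcb : ∀ n, ‖c v n‖ ≤ M * ‖v‖ := by
      intro n
      rw [hc]
      simp only
      rw [norm_smul, norm_inv, Real.norm_natCast]
      rcases Nat.eq_zero_or_pos n with rfl | hn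
      · simp; positivity
      · have hn' : (0 : ℝ) < n := by exact_mod_cast hn
        rw [inv_mul_le_iff₀ hn']
        refine (norm_sum_le_of_le _ fun k _ => hMv k v).trans ?_
        simp
    have hdiff : Tendsto (fun n => T (c v n) - c v n) atTop (𝓝 0) := by
      have heq : ∀ n, T (c v n) - c v n = (n : ℝ)⁻¹ • ((T ^ n) v - v) := by
        intro n
        rw [hc]
        simp only
        rw [map_smul, map_sum, ← smul_sub, ← Finset.sum_sub_distrib]
        congr 1
        have := Finset.sum_range_sub (fun k => (T ^ k) v) n
        simp only [pow_succ', pow_zero] at this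
        simpa using this
      simp_rw [heq]
      refine squeeze_zero_norm (a := fun n : ℕ => (n : ℝ)⁻¹ * (M * ‖v‖ + ‖v‖)) (fun n => ?_) ?_
      · rw [norm_smul, norm_inv, Real.norm_natCast]
        gcongr
        refine (norm_sub_le _ _).trans ?_
        gcongr
        exact hMv n v
      · simpa using (tendsto_inv_atTop_nhds_zero_nat (𝕜 := ℝ)).mul_const (M * ‖v‖ + ‖v‖)
    -- frequently away from zero
    obtain ⟨ε, hε, hfr⟩ : ∃ ε > 0, ∃ᶠ n in atTop, ε ≤ ‖c v n‖ := by
      by_contra hcon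
      push Not at hcon
      apply hvn
      rw [tendsto_zero_iff_norm_tendsto_zero, Metric.tendsto_nhds]
      intro ε hε
      filter_upwards [hcon ε hε] with n hn
      simpa using hn
    obtain ⟨φ, hφ, hφε⟩ := extraction_of_frequently_atTop hfr
    obtain ⟨x₁, -, ψ, hψ, hlim⟩ := tendsto_subseq_of_bounded
      (Metric.isBounded_closedBall (x := (0 : V)) (r := M * ‖v‖)) (x := fun n => c v (φ n))
      (fun n => by simpa using hcb (φ n))
    refine ⟨x₁, ?_, ?_, ?_⟩
    · exact hKcl.mem_of_tendsto hlim (Eventually.of_forall fun n => hcK v hv _)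
    · rintro rfl
      have h1 : Tendsto (fun n => ‖c v (φ (ψ n))‖) atTop (𝓝 0) := by
        simpa using hlim.norm
      have := ge_of_tendsto' h1 (fun n => hφε (ψ n))
      linarith
    · have h1 : Tendsto (fun n => T (c v (φ (ψ n))) - c v (φ (ψ n))) atTop (𝓝 (T x₁ - x₁)) :=
        ((T.continuous.tendsto x₁).comp hlim).sub hlim
      have h2 := hdiff.comp (hφ.comp hψ).tendsto_atTop
      exact sub_eq_zero.mp (tendsto_nhds_unique h1 h2)
  -- invariants
  have hcesfix : ∀ z, S z = z → z = ⟪yt, z⟫ • xt := by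
    intro z hz
    have hk : ∀ k : ℕ, (S ^ k) z = z := by
      intro k
      induction k with
      | zero => simp
      | succ k ih => rw [pow_succ']; simp [ih, hz]
    refine tendsto_nhds_unique ?_ (hces z)
    refine tendsto_const_nhds.congr' ?_
    filter_upwards [eventually_ne_atTop 0] with n hn
    have hn' : (n : ℝ) ≠ 0 := by exact_mod_cast hn
    simp only [hk, Finset.sum_const, Finset.card_range]
    rw [← Nat.cast_smul_eq_nsmul ℝ, smul_smul, inv_mul_cancel₀ hn', one_smul]
  have hcesinv : ∀ w, (∀ z, ⟪w, S z⟫ = ⟪w, z⟫) → ∀ z, ⟪w, z⟫ = ⟪yt, z⟫ * ⟪w, xt⟫ := by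
    intro w hw z
    have hk : ∀ k : ℕ, ⟪w, (S ^ k) z⟫ = ⟪w, z⟫ := by
      intro k
      induction k with
      | zero => simp
      | succ k ih => rw [pow_succ', mul_apply_eq_comp, hw, ih]
    refine tendsto_nhds_unique ?_ (hsc w z)
    refine tendsto_const_nhds.congr' ?_
    filter_upwards [eventually_ne_atTop 0] with n hn
    have hn' : (n : ℝ) ≠ 0 := by exact_mod_cast hn
    simp only [hk, Finset.sum_const, Finset.card_range]
    rw [nsmul_eq_mul, inv_mul_cancel_left₀ hn']
  have hSfix : S xt = xt := by
    have h1 := hcesfix (tmul x₁ x₁) (by rw [hST, hx₁T])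
    have h2 : ⟪yt, tmul x₁ x₁⟫ ≠ 0 := by
      intro h0
      rw [h0, zero_smul] at h1
      have h3 := hinner x₁ x₁ x₁ x₁
      rw [h1] at h3
      simp [hx₁0] at h3
    have h3 : xt = (⟪yt, tmul x₁ x₁⟫)⁻¹ • tmul x₁ x₁ := by
      conv_rhs => rw [h1]
      rw [inner_smul_right, hxy, mul_one, smul_smul, inv_mul_cancel₀ h2, one_smul]
    rw [h3, map_smul, hST, hx₁T]
  have hytinv : ∀ z, ⟪yt, S z⟫ = ⟪yt, z⟫ := by
    intro z
    have h1 := hces (S z)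
    have h2 := (S.continuous.tendsto _).comp (hces z)
    have h3 : ∀ n : ℕ, S ((n : ℝ)⁻¹ • ∑ k ∈ Finset.range n, (S ^ k) z) =
        (n : ℝ)⁻¹ • ∑ k ∈ Finset.range n, (S ^ k) (S z) := by
      intro n
      rw [map_smul, map_sum]
      congr 1
      refine Finset.sum_congr rfl fun k _ => ?_
      have := congrArg (fun f : W →L[ℝ] W => f z) ((pow_succ S k).symm.trans (pow_succ' S k))
      simpa using this.symm
    have h4 := tendsto_nhds_unique h1 (h2.congr h3)
    rw [map_smul, hSfix] at h4
    exact smul_left_injective ℝ hxt h4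
  set κ := ⟪yt, tmul x₁ x₁⟫ with hκ
  have hxxt : tmul x₁ x₁ = κ • xt := hcesfix _ (by rw [hST, hx₁T])
  have hκ0 : κ ≠ 0 := by
    intro h0
    rw [h0, zero_smul] at hxxt
    have h3 := hinner x₁ x₁ x₁ x₁
    rw [hxxt] at h3
    simp [hx₁0] at h3
  have hκpos : 0 < κ := lt_of_le_of_ne (hyt _ hx₁K _ hx₁K) (Ne.symm hκ0)
  -- dual vector
  let lam : V →ₗ[ℝ] ℝ := κ⁻¹ • ((innerₛₗ ℝ yt : W →ₗ[ℝ] ℝ).comp (tmul.flip x₁))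
  obtain ⟨y₀, hy₀⟩ : ∃ y₀ : V, ∀ a, ⟪y₀, a⟫ = κ⁻¹ * ⟪yt, tmul a x₁⟫ := by
    refine ⟨(InnerProductSpace.toDual ℝ V).symm (LinearMap.toContinuousLinearMap lam), fun a => ?_⟩
    rw [InnerProductSpace.toDual_symm_apply]
    simp [lam]
  have hyx : ⟪y₀, x₁⟫ = 1 := by rw [hy₀, ← hκ, inv_mul_cancel₀ hκ0]
  have hyT : ∀ a, ⟪y₀, T a⟫ = ⟪y₀, a⟫ := by
    intro a
    rw [hy₀, hy₀, ← hytinv (tmul a x₁), hST, hx₁T]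
  have hyyS : ∀ z, ⟪tmul y₀ y₀, S z⟫ = ⟪tmul y₀ y₀, z⟫ := by
    have : ((innerₛₗ ℝ (tmul y₀ y₀) : W →ₗ[ℝ] ℝ).comp (S : W →ₗ[ℝ] W)) =
        (innerₛₗ ℝ (tmul y₀ y₀) : W →ₗ[ℝ] ℝ) := by
      refine LinearMap.ext_on hspan ?_
      rintro z ⟨a, b, rfl⟩
      simp [hST, hinner, hyT]
    intro z
    simpa using LinearMap.congr_fun this z
  have hker : ∀ a, ⟪y₀, a⟫ = 0 → ⟪yt, tmul a a⟫ = 0 := by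
    intro a ha
    have h1 := hcesinv _ hyyS (tmul a a)
    have h2 := hcesinv _ hyyS (tmul x₁ x₁)
    rw [hinner, ha, zero_mul] at h1
    rw [hinner, hyx, one_mul] at h2
    rcases mul_eq_zero.mp h1.symm with h | h
    · exact h
    · rw [h, mul_zero] at h2
      norm_num at h2
  refine ⟨x₁, hx₁K, y₀, ?_, hyx, ?_⟩
  · intro a ha
    rw [hy₀]
    exact mul_nonneg (inv_nonneg.mpr hκpos.le) (hyt _ ha _ hx₁K)
  have hconv0 : ∀ a, ⟪y₀, a⟫ = 0 → Tendsto (fun n : ℕ => (T ^ n) a) atTop (𝓝 0) := by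
    intro a ha
    have h1 := hsq a
    rw [hker a ha, zero_mul] at h1
    have h2 := h1.const_mul (M ^ 2)
    rw [mul_zero] at h2
    have h3 : Tendsto (fun n : ℕ => ‖(T ^ n) a‖ ^ 2) atTop (𝓝 0) := by
      refine squeeze_zero' (Eventually.of_forall fun n => by positivity) ?_ h2
      filter_upwards [eventually_ne_atTop 0] with n hn
      have hn' : (0 : ℝ) < n := by exact_mod_cast Nat.pos_of_ne_zero hn
      rw [mul_left_comm, ← div_eq_inv_mul, le_div_iff₀ hn', Finset.mul_sum]
      calc ‖(T ^ n) a‖ ^ 2 * n = ∑ k ∈ Finset.range n, ‖(T ^ n) a‖ ^ 2 := by simp [mul_comm]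
        _ ≤ _ := by
          refine Finset.sum_le_sum fun k hk => ?_
          rw [← mul_pow]
          gcongr
          have hk' : (n - k) + k = n := by
            have := Finset.mem_range.mp hk
            omega
          have h5 : (T ^ n) a = (T ^ (n - k)) ((T ^ k) a) := by
            conv_lhs => rw [← hk', pow_add]
            rfl
          rw [h5]
          exact hMv _ _
    rw [tendsto_zero_iff_norm_tendsto_zero]
    have h6 := h3.sqrt
    simpa [Real.sqrt_sq] using h6
  intro x
  have hfix : ∀ n : ℕ, (T ^ n) x₁ = x₁ := by
    intro n
    induction n with
    | zero => simp
    | succ n ih => rw [pow_succ]; simp [ih, hx₁T]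
  have h1 := hconv0 (x - ⟪y₀, x⟫ • x₁) (by rw [inner_sub_right, inner_smul_right, hyx]; ring)
  have h2 := h1.add_const (⟪y₀, x⟫ • x₁)
  simpa only [map_sub, map_smul, hfix, sub_add_cancel, zero_add] using h2

theorem stmt_10 (K : Set V) (hKcl : IsClosed K) (hKconv : Convex ℝ K)
    (hKcone : ∀ c : ℝ, 0 ≤ c → ∀ x ∈ K, c • x ∈ K)
    (hKint : (interior K).Nonempty) (hKpt : K ∩ (-K) = {(0 : V)})
    (tmul : V →ₗ[ℝ] V →ₗ[ℝ] W)
    (hinner : ∀ a c b d : V, ⟪tmul a b, tmul c d⟫ = ⟪a, c⟫ * ⟪b, d⟫)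
    (hspan : Submodule.span ℝ {z : W | ∃ a b, z = tmul a b} = ⊤)
    (Kt : Set W) (hKtcl : IsClosed Kt) (hKtconv : Convex ℝ Kt)
    (hKtcone : ∀ c : ℝ, 0 ≤ c → ∀ x ∈ Kt, c • x ∈ Kt)
    (hKt₁ : tensorCone tmul K K ⊆ Kt)
    (hKt₂ : Kt ⊆ dualSet (tensorCone tmul (dualSet K) (dualSet K)))
    (A : V →L[ℝ] V) (hA : ∀ x ∈ K, A x ∈ K)
    (B : W →L[ℝ] W) (hB : ∀ a b : V, B (tmul a b) = tmul (A a) (A b))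
    (hBpos : ∀ z ∈ Kt, B z ∈ Kt) :
    IsMixing K A ↔ IsErgodic Kt B := by
  have hinv : ∀ r : ℝ, ∀ a b : V,
      (((r ^ 2)⁻¹ : ℝ) • B) (tmul a b) = tmul ((r⁻¹ • A) a) ((r⁻¹ • A) b) := by
    intro r a b
    simp [hB, smul_smul, sq]
  have hmem : ∀ a ∈ K, ∀ b ∈ K, tmul a b ∈ Kt := fun a ha b hb =>
    hKt₁ ⟨1, fun _ => a, fun _ => b, fun _ => ha, fun _ => hb, by simp⟩
  constructor
  · rintro ⟨x₀, y₀, hr, hx₀, hy₀, hxy, hlim⟩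
    set r := specRad A with hrdef
    have hlimS : ∀ z : W, Tendsto (fun n : ℕ => (((r ^ 2)⁻¹ • B) ^ n) z) atTop
        (𝓝 (⟪tmul y₀ y₀, z⟫ • tmul x₀ x₀)) := by
      intro z
      have hz : z ∈ Submodule.span ℝ {z : W | ∃ a b, z = tmul a b} := by rw [hspan]; trivial
      induction hz using Submodule.span_induction with
      | mem z hz =>
        obtain ⟨a, b, rfl⟩ := hz
        simp_rw [h10_pow (hinv r)]
        have := h10_tmul_tendsto (tmul := tmul) (hlim a) (hlim b)
        simpa [hinner, smul_smul, mul_comm] using this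
      | zero => simp only [map_zero, inner_zero_right, zero_smul]; exact tendsto_const_nhds
      | add z w _ _ hz hw => simpa only [map_add, inner_add_right, add_smul] using hz.add hw
      | smul c z _ hz => simpa only [map_smul, inner_smul_right, mul_smul] using hz.const_smul c
    have hone : ⟪tmul y₀ y₀, tmul x₀ x₀⟫ = (1 : ℝ) := by rw [hinner, hxy, one_mul]
    have hspec : specRad B = r ^ 2 := by
      refine h10_specRad_eq B (r ^ 2) (by positivity) _ hlimS (tmul x₀ x₀) ?_
      intro h0
      rw [hone, one_smul] at h0
      rw [h0] at hone
      simp at hone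
    refine ⟨tmul x₀ x₀, tmul y₀ y₀, ?_, hmem _ hx₀ _ hx₀, ?_, hone, ?_⟩
    · rw [hspec]; positivity
    · intro z hz
      rw [real_inner_comm]
      exact hKt₂ hz _ ⟨1, fun _ => y₀, fun _ => y₀, fun _ => hy₀, fun _ => hy₀, by simp⟩
    · intro z
      rw [hspec]
      exact (hlimS z).cesaro_smul
  · rintro ⟨xt, yt, hs, hxt, hyt, hxy, hces⟩
    set s := specRad B with hsdef
    set r := Real.sqrt s with hrdef
    have hr : 0 < r := Real.sqrt_pos.mpr hs
    have hrs : r ^ 2 = s := Real.sq_sqrt hs.le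
    rw [← hrs] at hces
    obtain ⟨x₀, hx₀, y₀, hy₀, hxy₀, hlim⟩ := h10_main K hKcl hKconv hKcone hKint hKpt tmul hinner
      hspan (r⁻¹ • A) (fun x hx => hKcone _ (by positivity) _ (hA x hx)) ((r ^ 2)⁻¹ • B) (hinv r)
      xt yt (fun a ha b hb => hyt _ (hmem a ha b hb)) hxy hces
    have hspec : specRad A = r := by
      refine h10_specRad_eq A r hr _ hlim x₀ ?_
      intro h0
      rw [hxy₀, one_smul] at h0
      rw [h0] at hxy₀
      simp at hxy₀
    refine ⟨x₀, y₀, ?_, hx₀, hy₀, hxy₀, ?_⟩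
    · rw [hspec]; exact hr
    · rw [hspec]; exact hlim
end
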